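/- Let α ∈ ℝ, 0 < s < p < ∞, and let q(·) : ℝⁿ → (0,∞) be globally log-Hölder continuous with s < q₋ ≤ q₊ < ∞. Let δ_{q(·)/s}, δ_{(q(·)/s)'} ∈ (0,1) be constants satisfying the dyadic estimate ‖χ_E‖_Y/‖χ_B‖_Y ≤ C(|E|/|B|)^{δ_Y} (for all balls B and measurable E ⊆ B) for Y = L^{q(·)/s}(ℝⁿ) and Y = L^{(q(·)/s)'}(ℝⁿ) respectively, and assume −nδ_{q(·)/s} < sα < nδ_{(q(·)/s)'}. Let T be a map from measurable functions to measurable functions such that for every Λ ≥ 1 there is C(Λ) > 0 with ‖Tf‖_{L^s_w} ≤ C(Λ)‖f‖_{L^s_w} for every w ∈ A_1(ℝⁿ) with [w]_{A_1} ≤ Λ and every f ∈ L^s_w(ℝⁿ). Then there is C' > 0 such that ‖Tf‖_{K̇^{α,p}_{q(·)}} ≤ C'‖f‖_{K̇^{α,p}_{q(·)}} for every f ∈ K̇^{α,p}_{q(·)}(ℝⁿ). -/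

import Mathlib

open MeasureTheory ENNReal Set Filter
open scoped NNReal Topology

noncomputable section

/-- Euclidean space `ℝⁿ`. -/
abbrev Euc (n : ℕ) := EuclideanSpace ℝ (Fin n)

/-- The dyadic annulus `C_k = B(0,2^k) \ B(0,2^{k-1})`. -/
def annulus (n : ℕ) (k : ℤ) : Set (Euc n) :=
  Metric.ball (0 : Euc n) ((2 : ℝ) ^ k) \ Metric.ball (0 : Euc n) ((2 : ℝ) ^ (k - 1))

/-- The Hardy–Littlewood maximal operator, acting on nonnegative extended-real-valued
functions (representing `|f|`): `Mf(x) = sup_{B ∋ x} |B|⁻¹ ∫_B f`. -/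
def maximalFn {n : ℕ} (f : Euc n → ℝ≥0∞) (x : Euc n) : ℝ≥0∞ :=
  ⨆ (c : Euc n) (r : ℝ) (_ : 0 < r) (_ : x ∈ Metric.ball c r),
    (volume (Metric.ball c r))⁻¹ * ∫⁻ y in Metric.ball c r, f y ∂volume

/-- A ball Banach function space on `ℝⁿ`, encoded by its norm functional `N`,
defined on all nonnegative extended-real-valued measurable functions (a real measurable
function `f` has norm `N (fun x => ‖f x‖₊)`). -/
structure BallBFS (n : ℕ) where
  N : (Euc n → ℝ≥0∞) → ℝ≥0∞
  norm_zero_iff : ∀ f : Euc n → ℝ≥0∞, Measurable f → (N f = 0 ↔ f =ᵐ[volume] 0)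
  norm_mono : ∀ f g : Euc n → ℝ≥0∞, (∀ᵐ x ∂volume, g x ≤ f x) → N g ≤ N f
  norm_isup : ∀ f : ℕ → Euc n → ℝ≥0∞, (∀ m, ∀ᵐ x ∂volume, f m x ≤ f (m + 1) x) →
    N (fun x => ⨆ m, f m x) = ⨆ m, N (f m)
  ball_mem : ∀ (x : Euc n) (r : ℝ), 0 < r → N ((Metric.ball x r).indicator 1) < ∞
  norm_add : ∀ f g : Euc n → ℝ≥0∞, N (fun x => f x + g x) ≤ N f + N g
  ball_integral : ∀ (x : Euc n) (r : ℝ), 0 < r → ∃ C : ℝ≥0∞, 0 < C ∧ C < ∞ ∧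
    ∀ f : Euc n → ℝ≥0∞, N f < ∞ → ∫⁻ y in Metric.ball x r, f y ∂volume ≤ C * N f

/-- The associate ("Köthe dual") norm of a norm functional `N`:
`‖g‖_{X'} = sup { ∫ f·g : ‖f‖_X ≤ 1 }`. -/
def assocN {n : ℕ} (N : (Euc n → ℝ≥0∞) → ℝ≥0∞) (g : Euc n → ℝ≥0∞) : ℝ≥0∞ :=
  ⨆ (f : Euc n → ℝ≥0∞) (_ : Measurable f) (_ : N f ≤ 1), ∫⁻ x, f x * g x ∂volume

/-- The homogeneous Herz-type quasinorm associated with a norm functional `N`,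
for a finite exponent `0 < p < ∞`:
`‖f‖ = (Σ_{k∈ℤ} 2^{kpα} ‖f χ_k‖_X ^ p)^{1/p}`. -/
def herzNorm {n : ℕ} (N : (Euc n → ℝ≥0∞) → ℝ≥0∞) (α p : ℝ) (f : Euc n → ℝ≥0∞) : ℝ≥0∞ :=
  (∑' k : ℤ, (2 : ℝ≥0∞) ^ ((k : ℝ) * p * α) * (N ((annulus n k).indicator f)) ^ p) ^ (1 / p)

/-- The homogeneous Herz-type quasinorm, with exponent `p ∈ (0,∞]`
(for `p = ∞` the sum is replaced by a supremum). -/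
def herzNormE {n : ℕ} (N : (Euc n → ℝ≥0∞) → ℝ≥0∞) (α : ℝ) (p : ℝ≥0∞)
    (f : Euc n → ℝ≥0∞) : ℝ≥0∞ :=
  if p = ∞ then ⨆ k : ℤ, (2 : ℝ≥0∞) ^ ((k : ℝ) * α) * N ((annulus n k).indicator f)
  else herzNorm N α p.toReal f

/-- The variable-exponent Lebesgue quasinorm
`‖f‖_{L^{q(·)}} = inf {λ > 0 : ∫ (|f(x)|/λ)^{q(x)} dx ≤ 1}` (equal to `∞` if no such `λ`
exists), applied to nonnegative extended-real-valued `f` (representing `|f|`). -/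
def varNorm {n : ℕ} (q : Euc n → ℝ) (f : Euc n → ℝ≥0∞) : ℝ≥0∞ :=
  ⨅ (lam : ℝ≥0∞) (_ : 0 < lam) (_ : lam ≠ ∞)
    (_ : ∫⁻ x, (f x / lam) ^ q x ∂volume ≤ 1), lam

/-- `q(·)` is globally log-Hölder continuous. -/
def LogHolder {n : ℕ} (q : Euc n → ℝ) : Prop :=
  ∃ C : ℝ, 0 < C ∧ ∃ qinf : ℝ,
    (∀ x y : Euc n, x ≠ y →
      |q x - q y| ≤ C / Real.log (Real.exp 1 + 1 / dist x y)) ∧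
    (∀ x : Euc n, |q x - qinf| ≤ C / Real.log (Real.exp 1 + ‖x‖))

/-- The Herz quasinorm of a real-valued function (finite exponent `p`). -/
def herzR {n : ℕ} (N : (Euc n → ℝ≥0∞) → ℝ≥0∞) (α p : ℝ) (f : Euc n → ℝ) : ℝ≥0∞ :=
  herzNorm N α p (fun x => (‖f x‖₊ : ℝ≥0∞))

/-- The weighted Lebesgue quasinorm `‖f‖_{L^s_w} = (∫ |f|^s w)^{1/s}`. -/
def wLpNorm {n : ℕ} (s : ℝ) (w : Euc n → ℝ≥0∞) (f : Euc n → ℝ) : ℝ≥0∞ :=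
  (∫⁻ x, (‖f x‖₊ : ℝ≥0∞) ^ s * w x ∂volume) ^ (1 / s)

/-- The Muckenhoupt `A₁` condition with constant (at most) `Λ`. -/
def IsA1 {n : ℕ} (Λ : ℝ≥0∞) (w : Euc n → ℝ≥0∞) : Prop :=
  Measurable w ∧ (∀ᵐ x ∂volume, 0 < w x ∧ w x < ∞) ∧
    (∀ (x : Euc n) (r : ℝ), 0 < r → ∫⁻ y in Metric.ball x r, w y ∂volume < ∞) ∧
    ∀ᵐ x ∂volume, maximalFn w x ≤ Λ * w x

section

variable {n : ℕ}

/-- Jensen's inequality for a finite measure, in the form of Hölder against `1`. -/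
theorem lintegral_rpow_le_measure_univ_mul {α : Type*} [MeasurableSpace α] (μ : Measure α)
    {m : ℝ} (hm : 1 ≤ m) {f : α → ℝ≥0∞} (hf : AEMeasurable f μ) :
    (∫⁻ x, f x ∂μ) ^ m ≤ μ univ ^ (m - 1) * ∫⁻ x, f x ^ m ∂μ := by
  rcases hm.eq_or_lt with rfl | hm
  · simp
  have hm0 : 0 < m := by linarith
  have hc : m.HolderConjugate (Real.conjExponent m) := Real.HolderConjugate.conjExponent hm
  have h := ENNReal.lintegral_mul_le_Lp_mul_Lq μ hc hf (aemeasurable_const (b := (1 : ℝ≥0∞)))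
  simp only [Pi.mul_apply, mul_one, ENNReal.one_rpow, lintegral_one] at h
  calc (∫⁻ x, f x ∂μ) ^ m
      ≤ ((∫⁻ a, f a ^ m ∂μ) ^ (1 / m) * μ univ ^ (1 / Real.conjExponent m)) ^ m := by gcongr
    _ = μ univ ^ (m - 1) * ∫⁻ x, f x ^ m ∂μ := by
      rw [ENNReal.mul_rpow_of_nonneg _ _ hm0.le, ← ENNReal.rpow_mul, ← ENNReal.rpow_mul,
        one_div_mul_cancel hm0.ne', ENNReal.rpow_one, mul_comm]
      congr 2
      rw [Real.conjExponent]
      field_simp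

theorem measurableSet_annulus (k : ℤ) : MeasurableSet (annulus n k) :=
  measurableSet_ball.diff measurableSet_ball

theorem maximalFn_ge (f : Euc n → ℝ≥0∞) {c x : Euc n} {r : ℝ} (hr : 0 < r)
    (hx : x ∈ Metric.ball c r) :
    (volume (Metric.ball c r))⁻¹ * ∫⁻ y in Metric.ball c r, f y ≤ maximalFn f x :=
  le_iSup₂_of_le c r (le_iSup₂_of_le hr hx le_rfl)

theorem maximalFn_le_iff {f : Euc n → ℝ≥0∞} {x : Euc n} {a : ℝ≥0∞} :
    maximalFn f x ≤ a ↔ ∀ (c : Euc n) (r : ℝ), 0 < r → x ∈ Metric.ball c r →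
      (volume (Metric.ball c r))⁻¹ * ∫⁻ y in Metric.ball c r, f y ≤ a := by
  simp only [maximalFn, iSup_le_iff]

theorem lt_maximalFn_iff {f : Euc n → ℝ≥0∞} {x : Euc n} {a : ℝ≥0∞} :
    a < maximalFn f x ↔ ∃ (c : Euc n) (r : ℝ), 0 < r ∧ x ∈ Metric.ball c r ∧
      a < (volume (Metric.ball c r))⁻¹ * ∫⁻ y in Metric.ball c r, f y := by
  simp only [maximalFn, lt_iSup_iff, exists_prop]

theorem isOpen_lt_maximalFn (f : Euc n → ℝ≥0∞) (a : ℝ≥0∞) :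
    IsOpen {x | a < maximalFn f x} := by
  rw [Metric.isOpen_iff]
  intro x hx
  obtain ⟨c, r, hr, hxc, hlt⟩ := lt_maximalFn_iff.1 hx
  obtain ⟨ε, hε, hsub⟩ := Metric.isOpen_iff.1 Metric.isOpen_ball x hxc
  exact ⟨ε, hε, fun y hy => lt_maximalFn_iff.2 ⟨c, r, hr, hsub hy, hlt⟩⟩

theorem measurable_maximalFn (f : Euc n → ℝ≥0∞) : Measurable (maximalFn f) :=
  measurable_of_Ioi fun a => (isOpen_lt_maximalFn f a).measurableSet

theorem maximalFn_mono {f g : Euc n → ℝ≥0∞} (h : ∀ᵐ x, f x ≤ g x) (x : Euc n) :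
    maximalFn f x ≤ maximalFn g x :=
  maximalFn_le_iff.2 fun c r hr hx => le_trans
    (by gcongr 1; exact lintegral_mono_ae (ae_restrict_of_ae h)) (maximalFn_ge g hr hx)

theorem maximalFn_tsum_le {ι : Type*} [Countable ι] (f : ι → Euc n → ℝ≥0∞)
    (hf : ∀ i, Measurable (f i)) (x : Euc n) :
    maximalFn (fun y => ∑' i, f i y) x ≤ ∑' i, maximalFn (f i) x := by
  refine maximalFn_le_iff.2 fun c r hr hx => ?_
  rw [lintegral_tsum fun i => (hf i).aemeasurable, ← ENNReal.tsum_mul_left]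
  exact ENNReal.tsum_le_tsum fun i => maximalFn_ge _ hr hx

theorem maximalFn_add_le (f g : Euc n → ℝ≥0∞) (hf : Measurable f) (x : Euc n) :
    maximalFn (fun y => f y + g y) x ≤ maximalFn f x + maximalFn g x := by
  refine maximalFn_le_iff.2 fun c r hr hx => ?_
  rw [lintegral_add_left hf, mul_add]
  exact add_le_add (maximalFn_ge _ hr hx) (maximalFn_ge _ hr hx)

theorem maximalFn_const_mul (a : ℝ≥0∞) {f : Euc n → ℝ≥0∞} (hf : Measurable f) (x : Euc n) :
    maximalFn (fun y => a * f y) x = a * maximalFn f x := by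
  simp only [maximalFn, lintegral_const_mul a hf, ENNReal.mul_iSup]
  refine iSup_congr fun c => iSup_congr fun r => iSup_congr fun _ => iSup_congr fun _ => ?_
  ring

theorem volume_ball_pos (c : Euc n) {r : ℝ} (hr : 0 < r) : 0 < volume (Metric.ball c r) :=
  Metric.measure_ball_pos volume c hr

theorem volume_ball_eq (c : Euc n) {r : ℝ} (hr : 0 < r) :
    volume (Metric.ball c r) =
      ENNReal.ofReal (r ^ n) * volume (Metric.ball (0 : Euc n) 1) := by
  simpa using Measure.addHaar_ball_of_pos (volume : Measure (Euc n)) c hr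

theorem maximalFn_le_const {f : Euc n → ℝ≥0∞} {a : ℝ≥0∞} (hf : ∀ x, f x ≤ a) (x : Euc n) :
    maximalFn f x ≤ a := by
  refine maximalFn_le_iff.2 fun c r hr _ => ?_
  have h0 := (volume_ball_pos c hr).ne'
  have h1 : volume (Metric.ball c r) ≠ ∞ := measure_ball_lt_top.ne
  calc (volume (Metric.ball c r))⁻¹ * ∫⁻ y in Metric.ball c r, f y
      ≤ (volume (Metric.ball c r))⁻¹ * ∫⁻ _ in Metric.ball c r, a := by
        gcongr; exact hf _
    _ = a := by
      rw [setLIntegral_const, mul_comm a, ← mul_assoc, ENNReal.inv_mul_cancel h0 h1, one_mul]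

theorem maximalFn_pos {f : Euc n → ℝ≥0∞} (hf : ∫⁻ x, f x ≠ 0) (x : Euc n) :
    0 < maximalFn f x := by
  by_contra h
  have h0 : ∀ m : ℕ, ∫⁻ y in Metric.ball x (m + 1), f y = 0 := by
    intro m
    have hr : (0 : ℝ) < m + 1 := by positivity
    have := (maximalFn_ge f hr (Metric.mem_ball_self hr)).trans (not_lt.1 h)
    have h1 : volume (Metric.ball x ((m : ℝ) + 1)) ≠ ∞ := measure_ball_lt_top.ne
    simpa [h1] using this
  have hU : (⋃ m : ℕ, Metric.ball x ((m : ℝ) + 1)) = univ := by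
    refine eq_univ_of_forall fun y => mem_iUnion.2 ?_
    obtain ⟨m, hm⟩ := exists_nat_gt (dist y x)
    exact ⟨m, by rw [Metric.mem_ball]; linarith⟩
  apply hf
  rw [← setLIntegral_univ, ← hU]
  exact le_antisymm ((lintegral_iUnion_le _ _).trans (by simp [h0])) zero_le

/-- The weak type `(1,1)` inequality. -/
theorem maximalFn_weak (hn : 0 < n) (f : Euc n → ℝ≥0∞) {a : ℝ≥0∞} (ha : a ≠ 0) (ha' : a ≠ ∞) :
    volume {x | a < maximalFn f x} ≤ 5 ^ n * (a⁻¹ * ∫⁻ x, f x) := by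
  have : Nonempty (Fin n) := ⟨⟨0, hn⟩⟩
  by_cases hfin : ∫⁻ x, f x = ∞
  · simp [hfin, ENNReal.mul_top, ha', ENNReal.inv_eq_zero]
  set t : Set (Euc n × ℝ) := {b | 0 < b.2 ∧
    a < (volume (Metric.ball b.1 b.2))⁻¹ * ∫⁻ y in Metric.ball b.1 b.2, f y} with ht
  have hvol : ∀ b ∈ t, volume (Metric.ball b.1 b.2) ≤ a⁻¹ * ∫⁻ y in Metric.ball b.1 b.2, f y := by
    rintro b ⟨hb, hlt⟩
    have h0 := (volume_ball_pos b.1 hb).ne'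
    have h1 : volume (Metric.ball b.1 b.2) ≠ ∞ := measure_ball_lt_top.ne
    rw [← ENNReal.div_eq_inv_mul, ENNReal.le_div_iff_mul_le (.inl ha) (.inl ha')]
    rw [← ENNReal.div_eq_inv_mul, ENNReal.lt_div_iff_mul_lt (.inl h0) (.inl h1)] at hlt
    rw [mul_comm]; exact hlt.le
  have hv0 := (volume_ball_pos (0 : Euc n) one_pos).ne'
  have hv1 : volume (Metric.ball (0 : Euc n) 1) ≠ ∞ := measure_ball_lt_top.ne
  set A : ℝ≥0∞ := (a⁻¹ * ∫⁻ x, f x) / volume (Metric.ball (0 : Euc n) 1) with hA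
  have hAtop : A ≠ ∞ :=
    ENNReal.div_ne_top (ENNReal.mul_ne_top (ENNReal.inv_ne_top.2 ha) hfin) hv0
  have hrad : ∀ b ∈ t, b.2 ≤ max 1 A.toReal := by
    intro b hb
    rcases le_or_gt b.2 1 with h | h
    · exact h.trans (le_max_left _ _)
    refine le_trans ?_ (le_max_right _ _)
    have h2 := (hvol b hb).trans
      (mul_le_mul_right (setLIntegral_le_lintegral (Metric.ball b.1 b.2) f) _)
    rw [volume_ball_eq _ hb.1, ← ENNReal.le_div_iff_mul_le (.inl hv0) (.inl hv1)] at h2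
    have h3 := (ENNReal.ofReal_le_iff_le_toReal hAtop).1 h2
    exact (le_self_pow₀ h.le hn.ne').trans h3
  obtain ⟨u, hut, hdisj, hcov⟩ :=
    Vitali.exists_disjoint_subfamily_covering_enlargement_closedBall t
      (fun b => b.1) (fun b => b.2) _ hrad 5 (by norm_num)
  have hdisj' : u.PairwiseDisjoint fun b => Metric.ball b.1 b.2 :=
    hdisj.mono fun b => Metric.ball_subset_closedBall
  have hcount : u.Countable := hdisj'.countable_of_isOpen (fun b _ => Metric.isOpen_ball)
    fun b hb => ⟨b.1, Metric.mem_ball_self (hut hb).1⟩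
  have hsub : {x | a < maximalFn f x} ⊆ ⋃ b ∈ u, Metric.closedBall b.1 (5 * b.2) := by
    intro x hx
    obtain ⟨c, r, hr, hxc, hlt⟩ := lt_maximalFn_iff.1 hx
    obtain ⟨b, hb, hbsub⟩ := hcov (c, r) ⟨hr, hlt⟩
    exact mem_iUnion₂.2 ⟨b, hb, hbsub (Metric.ball_subset_closedBall hxc)⟩
  calc volume {x | a < maximalFn f x}
      ≤ ∑' b : u, volume (Metric.closedBall b.1.1 (5 * b.1.2)) :=
        (measure_mono hsub).trans (measure_biUnion_le volume hcount _)
    _ ≤ ∑' b : u, 5 ^ n * (a⁻¹ * ∫⁻ y in Metric.ball b.1.1 b.1.2, f y) := by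
      refine ENNReal.tsum_le_tsum fun b => ?_
      have hb := (hut b.2).1
      rw [Measure.addHaar_closedBall_eq_addHaar_ball, volume_ball_eq _ (by positivity), mul_pow,
        ENNReal.ofReal_mul (by positivity), mul_assoc, ← volume_ball_eq b.1.1 hb]
      have : ENNReal.ofReal (5 ^ n) = 5 ^ n := by
        rw [ENNReal.ofReal_pow (by norm_num)]; norm_num
      rw [this]
      gcongr
      exact hvol _ (hut b.2)
    _ = 5 ^ n * (a⁻¹ * ∫⁻ y in ⋃ b ∈ u, Metric.ball b.1 b.2, f y) := by
      rw [ENNReal.tsum_mul_left, ENNReal.tsum_mul_left,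
        lintegral_biUnion hcount (fun b _ => measurableSet_ball) hdisj']
    _ ≤ 5 ^ n * (a⁻¹ * ∫⁻ x, f x) := by
      gcongr
      exact Measure.restrict_le_self

theorem two_rpow_ne_zero (x : ℝ) : (2 : ℝ≥0∞) ^ x ≠ 0 :=
  (ENNReal.rpow_pos (by norm_num) (by norm_num)).ne'

theorem two_rpow_ne_top (x : ℝ) : (2 : ℝ≥0∞) ^ x ≠ ∞ :=
  fun h => by simp [ENNReal.rpow_eq_top_iff] at h

theorem two_rpow_add (x y : ℝ) : (2 : ℝ≥0∞) ^ (x + y) = 2 ^ x * 2 ^ y :=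
  ENNReal.rpow_add _ _ (by norm_num) (by norm_num)

theorem tsum_two_rpow_neg_abs_lt_top {ε : ℝ} (hε : 0 < ε) :
    ∑' k : ℤ, (2 : ℝ≥0∞) ^ (-(ε * |(k : ℝ)|)) < ∞ := by
  have hr : (2 : ℝ≥0∞) ^ (-ε) < 1 := by
    rw [ENNReal.rpow_neg]
    exact ENNReal.inv_lt_one.2 (ENNReal.one_lt_rpow (by norm_num) hε)
  have hg : ∑' m : ℕ, ((2 : ℝ≥0∞) ^ (-ε)) ^ m < ∞ := by
    rw [ENNReal.tsum_geometric]
    exact ENNReal.inv_lt_top.2 (tsub_pos_of_lt hr)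
  have h1 : ∀ m : ℕ, (2 : ℝ≥0∞) ^ (-(ε * |((m : ℤ) : ℝ)|)) = ((2 : ℝ≥0∞) ^ (-ε)) ^ m := by
    intro m
    rw [← ENNReal.rpow_natCast, ← ENNReal.rpow_mul]
    simp
  have h2 : ∀ m : ℕ, (2 : ℝ≥0∞) ^ (-(ε * |((-((m : ℤ) + 1) : ℤ) : ℝ)|))
      ≤ ((2 : ℝ≥0∞) ^ (-ε)) ^ m := by
    intro m
    rw [← h1]
    refine ENNReal.rpow_le_rpow_of_exponent_le (by norm_num) ?_
    rw [neg_le_neg_iff]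
    push_cast
    rw [abs_neg, abs_of_nonneg (by positivity), abs_of_nonneg (by positivity)]
    nlinarith
  rw [tsum_of_nat_of_neg_add_one ENNReal.summable ENNReal.summable]
  simp_rw [h1]
  exact ENNReal.add_lt_top.2 ⟨hg, (ENNReal.tsum_le_tsum h2).trans_lt hg⟩

theorem volume_lt_maximalFn_le (hn : 0 < n) {f : Euc n → ℝ≥0∞} (hf : Measurable f) {a : ℝ≥0∞}
    (ha : a ≠ 0) (ha' : a ≠ ∞) :
    volume {x | 2 * a < maximalFn f x} ≤
      5 ^ n * (a⁻¹ * ∫⁻ x, {y | a < f y}.indicator f x) := by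
  have hm : MeasurableSet {y | a < f y} := measurableSet_lt measurable_const hf
  refine le_trans (measure_mono fun x hx => ?_) (maximalFn_weak hn _ ha ha')
  by_contra hle
  have hle : maximalFn ({y | a < f y}.indicator f) x ≤ a := not_lt.1 hle
  refine (not_lt.2 ?_ : ¬ 2 * a < maximalFn f x) hx
  calc maximalFn f x
      ≤ maximalFn (fun y => {y | a < f y}.indicator f y + a) x := by
        refine maximalFn_mono (.of_forall fun y => ?_) x
        by_cases hy : a < f y
        · rw [indicator_of_mem (show y ∈ {y | a < f y} from hy)]; exact le_self_add
        · exact (not_lt.1 hy).trans le_add_self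
    _ ≤ maximalFn ({y | a < f y}.indicator f) x + maximalFn (fun _ => a) x :=
        maximalFn_add_le _ _ (hf.indicator hm) x
    _ ≤ a + a := add_le_add hle (maximalFn_le_const (fun _ => le_rfl) x)
    _ = 2 * a := (two_mul a).symm

theorem rpow_le_tsum_zpow {a : ℝ} (ha : 0 < a) (y : ℝ≥0∞) :
    y ^ a ≤ ∑' k : ℤ, {z : ℝ≥0∞ | 2 * 2 ^ (k : ℝ) < z}.indicator
      (fun _ => (2 : ℝ≥0∞) ^ (((k : ℝ) + 2) * a)) y := by
  have key : ∀ (k : ℤ), 2 * 2 ^ (k : ℝ) < y → (2 : ℝ≥0∞) ^ (((k : ℝ) + 2) * a) ≤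
      ∑' k : ℤ, {z : ℝ≥0∞ | 2 * 2 ^ (k : ℝ) < z}.indicator
      (fun _ => (2 : ℝ≥0∞) ^ (((k : ℝ) + 2) * a)) y := by
    intro k hk
    refine le_trans ?_ (ENNReal.le_tsum k)
    rw [indicator_of_mem (show y ∈ {z : ℝ≥0∞ | 2 * 2 ^ (k : ℝ) < z} from hk)]
  rcases eq_or_ne y 0 with rfl | h0
  · simp [ha]
  rcases eq_or_ne y ∞ with rfl | h1
  · rw [ENNReal.top_rpow_of_pos ha]
    refine top_le_iff.2 (ENNReal.eq_top_of_forall_nnreal_le fun b => ?_)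
    obtain ⟨m, hm⟩ := exists_nat_gt (2 * (b : ℝ) / a)
    refine le_trans ?_ (key m ?_)
    · have hb : (b : ℝ) ≤ (2 : ℝ) ^ (((m : ℝ) + 2) * a) := by
        have h2 : 2 * (b : ℝ) ≤ m * a := by rw [div_lt_iff₀ ha] at hm; exact hm.le
        have h3 := one_add_mul_self_le_rpow_one_add (s := 1) (by norm_num)
          (p := 1 + ((m : ℝ) + 2) * a) (by nlinarith [m.cast_nonneg (α := ℝ)])
        rw [Real.rpow_add (by norm_num)] at h3
        norm_num at h3
        nlinarith
      rw [← ENNReal.ofReal_coe_nnreal]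
      refine (ENNReal.ofReal_le_ofReal hb).trans ?_
      rw [← ENNReal.ofReal_rpow_of_pos (by norm_num)]
      norm_num
    · exact ENNReal.mul_lt_top (by norm_num)
        (ENNReal.rpow_lt_top_of_nonneg (by positivity) (by norm_num))
  · obtain ⟨m, hm1, hm2⟩ := ENNReal.exists_mem_Ioc_zpow h0 h1 (y := 2) (by norm_num) (by norm_num)
    rw [← ENNReal.rpow_intCast] at hm1 hm2
    refine le_trans ?_ (key (m - 1) ?_)
    · rw [ENNReal.rpow_mul]
      refine ENNReal.rpow_le_rpow (hm2.trans (le_of_eq ?_)) ha.le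
      push_cast; congr 1; ring
    · refine lt_of_eq_of_lt ?_ hm1
      nth_rewrite 1 [← ENNReal.rpow_one 2]
      rw [← ENNReal.rpow_add _ _ (by norm_num) (by norm_num)]
      push_cast; congr 1; ring

theorem tsum_zpow_indicator_le {a : ℝ} (ha : 1 < a) (y : ℝ≥0∞) :
    ∑' k : ℤ, (2 : ℝ≥0∞) ^ (((k : ℝ) + 2) * a) *
      ((2 ^ (k : ℝ))⁻¹ * {z : ℝ≥0∞ | 2 ^ (k : ℝ) < z}.indicator id y) ≤
    4 ^ a * (∑' k : ℤ, (2 : ℝ≥0∞) ^ (-((a - 1) * |(k : ℝ)|))) * y ^ a := by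
  have ha0 : 0 < a := by linarith
  rcases eq_or_ne y 0 with rfl | h0
  · simp
  rcases eq_or_ne y ∞ with rfl | h1
  · rw [ENNReal.top_rpow_of_pos ha0, ENNReal.mul_top]
    · exact le_top
    · refine mul_ne_zero (by simp [ENNReal.rpow_eq_zero_iff]) ?_
      intro h
      have := ENNReal.tsum_eq_zero.1 h 0
      simp at this
  obtain ⟨m, hm1, hm2⟩ := ENNReal.exists_mem_Ioc_zpow h0 h1 (y := 2) (by norm_num) (by norm_num)
  rw [← ENNReal.rpow_intCast] at hm1 hm2
  have hy : y ^ a = y ^ (a - 1) * y := by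
    nth_rewrite 3 [← ENNReal.rpow_one y]
    rw [← ENNReal.rpow_add _ _ h0 h1]; congr 1; ring
  have hmy : (2 : ℝ≥0∞) ^ ((m : ℝ) * (a - 1)) ≤ y ^ (a - 1) := by
    rw [ENNReal.rpow_mul]; exact ENNReal.rpow_le_rpow hm1.le (by linarith)
  have hshift : (∑' k : ℤ, (2 : ℝ≥0∞) ^ (-((a - 1) * |(k : ℝ)|))) =
      ∑' k : ℤ, (2 : ℝ≥0∞) ^ (-((a - 1) * |((m - k : ℤ) : ℝ)|)) :=
    ((Equiv.subLeft m).tsum_eq (fun k : ℤ => (2 : ℝ≥0∞) ^ (-((a - 1) * |(k : ℝ)|)))).symm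
  rw [hshift, ← ENNReal.tsum_mul_left, ← ENNReal.tsum_mul_right]
  refine ENNReal.tsum_le_tsum fun k => ?_
  by_cases hk : (2 : ℝ≥0∞) ^ (k : ℝ) < y
  · rw [indicator_of_mem (show y ∈ {z : ℝ≥0∞ | 2 ^ (k : ℝ) < z} from hk), id, hy]
    have hkm : k ≤ m := by
      have := hk.trans_le hm2
      by_contra hcon
      refine absurd this (not_lt.2 (ENNReal.rpow_le_rpow_of_exponent_le (by norm_num) ?_))
      exact_mod_cast not_le.1 hcon
    have habs : |((m - k : ℤ) : ℝ)| = m - k := by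
      push_cast
      exact abs_of_nonneg (sub_nonneg.2 (by exact_mod_cast hkm))
    rw [habs, ← ENNReal.rpow_neg]
    have h4 : (4 : ℝ≥0∞) ^ a = 2 ^ (2 * a) := by
      rw [ENNReal.rpow_mul]; norm_num
    calc (2 : ℝ≥0∞) ^ (((k : ℝ) + 2) * a) * (2 ^ (-(k : ℝ)) * y)
        = 2 ^ (2 * a) * 2 ^ (-((a - 1) * ((m : ℝ) - k))) * 2 ^ ((m : ℝ) * (a - 1)) * y := by
          rw [← mul_assoc, ← ENNReal.rpow_add _ _ (by norm_num) (by norm_num),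
            ← ENNReal.rpow_add _ _ (by norm_num) (by norm_num),
            ← ENNReal.rpow_add _ _ (by norm_num) (by norm_num)]
          congr 2; ring
      _ ≤ 4 ^ a * 2 ^ (-((a - 1) * ((m : ℝ) - k))) * (y ^ (a - 1) * y) := by
          rw [h4, ← mul_assoc]; gcongr
  · rw [indicator_of_notMem (show y ∉ {z : ℝ≥0∞ | 2 ^ (k : ℝ) < z} from hk)]
    simp

/-- The maximal operator is bounded on `L^a` for `1 < a < ∞`. -/
theorem exists_lintegral_maximalFn_rpow_le (hn : 0 < n) {a : ℝ} (ha : 1 < a) :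
    ∃ K : ℝ≥0∞, K < ∞ ∧ ∀ f : Euc n → ℝ≥0∞, Measurable f →
      ∫⁻ x, maximalFn f x ^ a ≤ K * ∫⁻ x, f x ^ a := by
  have ha0 : 0 < a := by linarith
  refine ⟨5 ^ n * (4 ^ a * ∑' k : ℤ, (2 : ℝ≥0∞) ^ (-((a - 1) * |(k : ℝ)|))), ?_, ?_⟩
  · exact ENNReal.mul_lt_top (ENNReal.pow_lt_top (by norm_num))
      (ENNReal.mul_lt_top (ENNReal.rpow_lt_top_of_nonneg ha0.le (by norm_num))
        (tsum_two_rpow_neg_abs_lt_top (by linarith)))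
  intro f hf
  have hind : ∀ (k : ℤ), Measurable
      ({z : ℝ≥0∞ | 2 * 2 ^ (k : ℝ) < z}.indicator (fun _ => (2 : ℝ≥0∞) ^ (((k : ℝ) + 2) * a))) :=
    fun k => measurable_const.indicator measurableSet_Ioi
  have hind' : ∀ (k : ℤ), Measurable ({z : ℝ≥0∞ | 2 ^ (k : ℝ) < z}.indicator id) :=
    fun k => measurable_id.indicator measurableSet_Ioi
  calc ∫⁻ x, maximalFn f x ^ a
      ≤ ∫⁻ x, ∑' k : ℤ, {z : ℝ≥0∞ | 2 * 2 ^ (k : ℝ) < z}.indicator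
          (fun _ => (2 : ℝ≥0∞) ^ (((k : ℝ) + 2) * a)) (maximalFn f x) :=
        lintegral_mono fun x => rpow_le_tsum_zpow ha0 _
    _ = ∑' k : ℤ, (2 : ℝ≥0∞) ^ (((k : ℝ) + 2) * a) *
          volume {x | 2 * 2 ^ (k : ℝ) < maximalFn f x} := by
        rw [lintegral_tsum]
        swap
        · exact fun k => ((hind k).comp (measurable_maximalFn f)).aemeasurable
        refine tsum_congr fun k => ?_
        rw [← lintegral_indicator_const]
        · rfl
        · exact (isOpen_lt_maximalFn f _).measurableSet
    _ ≤ ∑' k : ℤ, (2 : ℝ≥0∞) ^ (((k : ℝ) + 2) * a) * (5 ^ n * ((2 ^ (k : ℝ))⁻¹ *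
          ∫⁻ x, {z : ℝ≥0∞ | 2 ^ (k : ℝ) < z}.indicator id (f x))) := by
        refine ENNReal.tsum_le_tsum fun k => ?_
        gcongr
        refine (volume_lt_maximalFn_le hn hf ?_ ?_).trans (le_of_eq ?_)
        · exact two_rpow_ne_zero _
        · exact two_rpow_ne_top _
        · rfl
    _ = 5 ^ n * ∫⁻ x, ∑' k : ℤ, (2 : ℝ≥0∞) ^ (((k : ℝ) + 2) * a) * ((2 ^ (k : ℝ))⁻¹ *
          {z : ℝ≥0∞ | 2 ^ (k : ℝ) < z}.indicator id (f x)) := by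
        rw [lintegral_tsum, ← ENNReal.tsum_mul_left]
        · refine tsum_congr fun k => ?_
          rw [lintegral_const_mul, lintegral_const_mul]
          · ring
          · exact (hind' k).comp hf
          · exact ((hind' k).comp hf).const_mul _
        · exact fun k => ((((hind' k).comp hf).const_mul _).const_mul _).aemeasurable
    _ ≤ 5 ^ n * ∫⁻ x, 4 ^ a * (∑' k : ℤ, (2 : ℝ≥0∞) ^ (-((a - 1) * |(k : ℝ)|))) * f x ^ a := by
        gcongr
        exact tsum_zpow_indicator_le ha _
    _ = _ := by
        rw [lintegral_const_mul _ (hf.pow_const a)]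
        ring

theorem varNorm_le {q : Euc n → ℝ} {f : Euc n → ℝ≥0∞} {c : ℝ≥0∞} (h0 : 0 < c) (h1 : c ≠ ∞)
    (h : ∫⁻ x, (f x / c) ^ q x ≤ 1) : varNorm q f ≤ c :=
  iInf₂_le_of_le c h0 (iInf₂_le_of_le h1 h le_rfl)

theorem le_varNorm {q : Euc n → ℝ} {f : Euc n → ℝ≥0∞} {X : ℝ≥0∞}
    (h : ∀ c : ℝ≥0∞, 0 < c → c ≠ ∞ → ∫⁻ x, (f x / c) ^ q x ≤ 1 → X ≤ c) : X ≤ varNorm q f :=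
  le_iInf₂ fun c h0 => le_iInf₂ fun h1 h2 => h c h0 h1 h2

theorem le_mul_varNorm {q : Euc n → ℝ} {f : Euc n → ℝ≥0∞} {X K : ℝ≥0∞} (hK : K ≠ 0)
    (hK' : K ≠ ∞)
    (h : ∀ c : ℝ≥0∞, 0 < c → c ≠ ∞ → ∫⁻ x, (f x / c) ^ q x ≤ 1 → X ≤ K * c) :
    X ≤ K * varNorm q f := by
  rw [← ENNReal.div_le_iff' hK hK']
  exact le_varNorm fun c h0 h1 h2 =>
    (ENNReal.div_le_iff' hK hK').2 (h c h0 h1 h2)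

theorem varNorm_congr_exponent {q q' : Euc n → ℝ} (h : q =ᵐ[volume] q') (f : Euc n → ℝ≥0∞) :
    varNorm q f = varNorm q' f := by
  have : ∀ c : ℝ≥0∞, ∫⁻ x, (f x / c) ^ q x = ∫⁻ x, (f x / c) ^ q' x := fun c =>
    lintegral_congr_ae (h.mono fun x hx => by simp only [hx])
  simp only [varNorm, this]

theorem varNorm_mono {q : Euc n → ℝ} (hq : ∀ x, 0 ≤ q x) {f g : Euc n → ℝ≥0∞}
    (h : ∀ᵐ x, f x ≤ g x) : varNorm q f ≤ varNorm q g :=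
  le_varNorm fun _ h0 h1 h2 => varNorm_le h0 h1 <| le_trans
    (lintegral_mono_ae (h.mono fun x hx =>
      ENNReal.rpow_le_rpow (ENNReal.div_le_div_right hx _) (hq x))) h2

theorem varNorm_zero {q : Euc n → ℝ} (hq : ∀ x, 0 < q x) {f : Euc n → ℝ≥0∞}
    (hf : ∀ x, f x = 0) : varNorm q f = 0 := by
  have h : ∀ c : ℝ≥0, 0 < c → varNorm q f ≤ c := fun c hc =>
    varNorm_le (by exact_mod_cast hc) ENNReal.coe_ne_top (by simp [hf, hq])
  refine le_antisymm (ENNReal.le_of_forall_pos_le_add fun c hc _ => ?_) zero_le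
  simpa using h c hc

theorem varNorm_const_mul_le (q : Euc n → ℝ) (f : Euc n → ℝ≥0∞) {a : ℝ≥0∞} (h0 : a ≠ 0)
    (h1 : a ≠ ∞) : varNorm q (fun x => a * f x) ≤ a * varNorm q f :=
  le_mul_varNorm h0 h1 fun c hc0 hc1 h =>
    varNorm_le (ENNReal.mul_pos h0 hc0.ne') (ENNReal.mul_ne_top h1 hc1) <| by
      simpa only [ENNReal.mul_div_mul_left _ _ h0 h1] using h

theorem const_mul_varNorm_le (q : Euc n → ℝ) (f : Euc n → ℝ≥0∞) {a : ℝ≥0∞} (h0 : a ≠ 0)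
    (h1 : a ≠ ∞) : a * varNorm q f ≤ varNorm q (fun x => a * f x) := by
  have h := varNorm_const_mul_le q (fun x => a * f x) (ENNReal.inv_ne_zero.2 h1)
    (ENNReal.inv_ne_top.2 h0)
  simp only [← mul_assoc, ENNReal.inv_mul_cancel h0 h1, one_mul] at h
  calc a * varNorm q f ≤ a * (a⁻¹ * varNorm q fun x => a * f x) := by gcongr
    _ = _ := by rw [← mul_assoc, ENNReal.mul_inv_cancel h0 h1, one_mul]

/-- For exponents at least `1`, a bound on the modular gives a bound on the norm. -/
theorem varNorm_le_mul_of_lintegral_le {q : Euc n → ℝ} (hq : ∀ x, 1 ≤ q x)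
    {f : Euc n → ℝ≥0∞} {c B : ℝ≥0∞} (h0 : 0 < c) (h1 : c ≠ ∞) (hB : 1 ≤ B) (hB' : B ≠ ∞)
    (h : ∫⁻ x, (f x / c) ^ q x ≤ B) : varNorm q f ≤ B * c := by
  have hB0 : B ≠ 0 := (zero_lt_one.trans_le hB).ne'
  refine varNorm_le (ENNReal.mul_pos hB0 h0.ne') (ENNReal.mul_ne_top hB' h1) ?_
  calc ∫⁻ x, (f x / (B * c)) ^ q x ≤ ∫⁻ x, B⁻¹ * (f x / c) ^ q x := by
        refine lintegral_mono fun x => ?_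
        have : f x / (B * c) = B⁻¹ * (f x / c) := by
          rw [div_eq_mul_inv, div_eq_mul_inv, ENNReal.mul_inv (.inl hB0) (.inl hB')]; ring
        rw [this, ENNReal.mul_rpow_of_nonneg _ _ (zero_le_one.trans (hq x))]
        gcongr
        calc B⁻¹ ^ q x ≤ B⁻¹ ^ (1 : ℝ) :=
              ENNReal.rpow_le_rpow_of_exponent_ge (ENNReal.inv_le_one.2 hB) (hq x)
          _ = B⁻¹ := ENNReal.rpow_one _
    _ = B⁻¹ * ∫⁻ x, (f x / c) ^ q x := lintegral_const_mul' _ _ (ENNReal.inv_ne_top.2 hB0)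
    _ ≤ B⁻¹ * B := by gcongr
    _ = 1 := ENNReal.inv_mul_cancel hB0 hB'

theorem measurable_div_rpow {q : Euc n → ℝ} (hq : Measurable q) {f : Euc n → ℝ≥0∞}
    (hf : Measurable f) (c : ℝ≥0∞) : Measurable fun x => (f x / c) ^ q x :=
  (hf.div_const c).pow hq

theorem varNorm_add_le {q : Euc n → ℝ} (hqm : Measurable q) (hq : ∀ x, 1 ≤ q x)
    {f g : Euc n → ℝ≥0∞} (hf : Measurable f) :
    varNorm q (fun x => f x + g x) ≤ 4 * (varNorm q f + varNorm q g) := by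
  have h4 : (4 : ℝ≥0∞) ≠ 0 := by norm_num
  have h4' : (4 : ℝ≥0∞) ≠ ∞ := by norm_num
  rw [← ENNReal.div_le_iff' h4 h4', ← tsub_le_iff_right]
  refine le_varNorm fun c hc0 hc1 hc => ?_
  rw [tsub_le_iff_right, ← tsub_le_iff_left]
  refine le_varNorm fun d hd0 hd1 hd => ?_
  rw [tsub_le_iff_left, ENNReal.div_le_iff' h4 h4']
  have hcd : c + d ≠ ∞ := ENNReal.add_ne_top.2 ⟨hc1, hd1⟩
  calc varNorm q (fun x => f x + g x) ≤ 2 * (2 * (c + d)) := by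
        refine varNorm_le_mul_of_lintegral_le hq (by positivity)
          (ENNReal.mul_ne_top (by norm_num) hcd) (by norm_num) (by norm_num) ?_
        calc ∫⁻ x, ((f x + g x) / (2 * (c + d))) ^ q x
            ≤ ∫⁻ x, ((f x / c) ^ q x + (g x / d) ^ q x) := by
              refine lintegral_mono fun x => ?_
              have hq0 : 0 ≤ q x := zero_le_one.trans (hq x)
              have hmax : (f x + g x) / (2 * (c + d)) ≤ max (f x / c) (g x / d) := by
                rw [ENNReal.div_le_iff (by positivity) (ENNReal.mul_ne_top (by norm_num) hcd)]
                have e1 : f x ≤ max (f x / c) (g x / d) * (c + d) :=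
                  (ENNReal.div_le_iff hc0.ne' hc1).1 (le_max_left _ _) |>.trans
                    (by gcongr; exact le_self_add)
                have e2 : g x ≤ max (f x / c) (g x / d) * (c + d) :=
                  (ENNReal.div_le_iff hd0.ne' hd1).1 (le_max_right _ _) |>.trans
                    (by gcongr; exact le_add_self)
                calc f x + g x ≤ _ := add_le_add e1 e2
                  _ = _ := by ring
              refine (ENNReal.rpow_le_rpow hmax hq0).trans ?_
              rcases le_total (f x / c) (g x / d) with h | h
              · rw [max_eq_right h]; exact le_add_self
              · rw [max_eq_left h]; exact le_self_add
          _ = (∫⁻ x, (f x / c) ^ q x) + ∫⁻ x, (g x / d) ^ q x :=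
              lintegral_add_left (measurable_div_rpow hqm hf c) _
          _ ≤ 1 + 1 := add_le_add hc hd
          _ = 2 := by norm_num
    _ = 4 * (c + d) := by ring

/-- Hölder's inequality for variable exponents. -/
theorem lintegral_mul_le_varNorm {t r : Euc n → ℝ} (ht : Measurable t)
    (htr : ∀ x, (t x).HolderConjugate (r x)) {f g : Euc n → ℝ≥0∞} (hf : Measurable f)
    (hf' : varNorm t f ≠ ∞) (hg : varNorm r g ≠ ∞) :
    ∫⁻ x, f x * g x ≤ 2 * varNorm r g * varNorm t f := by
  have key : ∀ c : ℝ≥0∞, 0 < c → c ≠ ∞ → ∫⁻ x, (f x / c) ^ t x ≤ 1 →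
      ∀ d : ℝ≥0∞, 0 < d → d ≠ ∞ → ∫⁻ x, (g x / d) ^ r x ≤ 1 →
      ∫⁻ x, f x * g x ≤ 2 * c * d := by
    intro c hc0 hc1 hc d hd0 hd1 hd
    calc ∫⁻ x, f x * g x ≤ ∫⁻ x, c * d * ((f x / c) ^ t x + (g x / d) ^ r x) := by
          refine lintegral_mono fun x => ?_
          have hy := ENNReal.young_inequality (f x / c) (g x / d) (htr x)
          calc f x * g x = c * d * (f x / c * (g x / d)) := by
                rw [show c * d * (f x / c * (g x / d)) = (f x / c * c) * (g x / d * d) by ring,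
                  ENNReal.div_mul_cancel hc0.ne' hc1, ENNReal.div_mul_cancel hd0.ne' hd1]
            _ ≤ c * d * ((f x / c) ^ t x / ENNReal.ofReal (t x) +
                  (g x / d) ^ r x / ENNReal.ofReal (r x)) := by gcongr
            _ ≤ c * d * ((f x / c) ^ t x + (g x / d) ^ r x) := by
                have e1 : (1 : ℝ≥0∞) ≤ ENNReal.ofReal (t x) :=
                  ENNReal.one_le_ofReal.2 (htr x).lt.le
                have e2 : (1 : ℝ≥0∞) ≤ ENNReal.ofReal (r x) :=
                  ENNReal.one_le_ofReal.2 (htr x).symm.lt.le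
                gcongr
                · exact ENNReal.div_le_of_le_mul (le_mul_of_one_le_right' e1)
                · exact ENNReal.div_le_of_le_mul (le_mul_of_one_le_right' e2)
      _ = c * d * ((∫⁻ x, (f x / c) ^ t x) + ∫⁻ x, (g x / d) ^ r x) := by
          rw [lintegral_const_mul' _ _ (ENNReal.mul_ne_top hc1 hd1),
            lintegral_add_left (measurable_div_rpow ht hf c)]
      _ ≤ c * d * (1 + 1) := by gcongr
      _ = 2 * c * d := by rw [one_add_one_eq_two]; ring
  have key2 : ∀ c : ℝ≥0∞, 0 < c → c ≠ ∞ → ∫⁻ x, (f x / c) ^ t x ≤ 1 →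
      ∫⁻ x, f x * g x ≤ 2 * varNorm r g * c := by
    intro c hc0 hc1 hc
    rw [show 2 * varNorm r g * c = 2 * c * varNorm r g by ring]
    exact le_mul_varNorm (by positivity) (ENNReal.mul_ne_top (by norm_num) hc1)
      (key c hc0 hc1 hc)
  rcases eq_or_ne (varNorm r g) 0 with h0 | h0
  · rw [h0, mul_zero, zero_mul]
    by_cases hex : ∃ c : ℝ≥0∞, 0 < c ∧ c ≠ ∞ ∧ ∫⁻ x, (f x / c) ^ t x ≤ 1
    · obtain ⟨c, hc0, hc1, hc⟩ := hex
      have := key2 c hc0 hc1 hc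
      rwa [h0, mul_zero, zero_mul] at this
    · refine absurd (top_le_iff.1 (le_varNorm fun c hc0 hc1 hc => ?_)) hf'
      exact absurd ⟨c, hc0, hc1, hc⟩ hex
  · exact le_mul_varNorm (by positivity) (ENNReal.mul_ne_top (by norm_num) hg) key2

theorem varNorm_indicator_one_lt_top {q : Euc n → ℝ} (hq : ∀ x, 1 ≤ q x) {S : Set (Euc n)}
    (hS : MeasurableSet S) (hv : volume S < ∞) : varNorm q (S.indicator 1) < ∞ := by
  have h1 : max 1 (volume S) ≠ ∞ := by simp [hv.ne]
  refine (varNorm_le_mul_of_lintegral_le (c := 1) (B := max 1 (volume S)) hq one_pos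
    ENNReal.one_ne_top (le_max_left _ _) h1 ?_).trans_lt (by simpa using hv)
  refine le_trans (le_of_eq ?_) (le_max_right _ _)
  rw [← lintegral_indicator_one hS]
  refine lintegral_congr fun x => ?_
  have hq0 : 0 < q x := zero_lt_one.trans_le (hq x)
  by_cases hx : x ∈ S <;> simp [hx, hq0]

theorem varNorm_rpow {q : Euc n → ℝ} {s : ℝ} (hs : 0 < s) (f : Euc n → ℝ≥0∞) :
    varNorm q f ^ s = varNorm (fun x => q x / s) (fun x => f x ^ s) := by
  refine le_antisymm (le_varNorm fun c h0 h1 h => ?_) ?_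
  · rw [← ENNReal.le_rpow_inv_iff hs]
    refine varNorm_le (ENNReal.rpow_pos h0 h1)
      (ENNReal.rpow_ne_top_of_nonneg (by positivity) h1) (le_trans (le_of_eq ?_) h)
    refine lintegral_congr fun x => ?_
    rw [show q x = s * (q x / s) by field_simp, ENNReal.rpow_mul,
      ENNReal.div_rpow_of_nonneg _ _ hs.le, ← ENNReal.rpow_mul, inv_mul_cancel₀ hs.ne',
      ENNReal.rpow_one]
    congr 1; field_simp
  · rw [← ENNReal.rpow_inv_le_iff hs]
    refine le_varNorm fun c h0 h1 h => ?_
    rw [ENNReal.rpow_inv_le_iff hs]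
    refine varNorm_le (ENNReal.rpow_pos h0 h1)
      (ENNReal.rpow_ne_top_of_nonneg hs.le h1) (le_trans (le_of_eq ?_) h)
    refine lintegral_congr fun x => ?_
    rw [← ENNReal.div_rpow_of_nonneg _ _ hs.le, ← ENNReal.rpow_mul]
    congr 1; field_simp

/-- Norming functions for variable Lebesgue spaces. -/
theorem exists_le_lintegral_mul {t r : Euc n → ℝ} (ht : Measurable t)
    (htr : ∀ x, (t x).HolderConjugate (r x)) {tb : ℝ} (htb : ∀ x, t x ≤ tb)
    {f : Euc n → ℝ≥0∞} (hf : Measurable f) (hf' : ∀ x, f x ≠ ∞) {b : ℝ≥0∞}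
    (hb : b < varNorm t f) :
    ∃ g : Euc n → ℝ≥0∞, Measurable g ∧ varNorm r g ≤ 1 ∧ (∀ x, f x = 0 → g x = 0) ∧
      b ≤ ∫⁻ x, f x * g x := by
  rcases eq_or_ne b 0 with rfl | hb0
  · refine ⟨fun _ => 0, measurable_const, ?_, fun _ _ => rfl, zero_le⟩
    rw [varNorm_zero (fun x => (htr x).symm.pos) fun _ => rfl]
    exact zero_le
  have hb1 : b ≠ ∞ := hb.ne_top
  have h1 : 1 < ∫⁻ x, (f x / b) ^ t x := by
    by_contra h
    exact absurd (varNorm_le hb0.bot_lt hb1 (not_lt.1 h)) (not_le.2 hb)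
  set E : ℕ → Set (Euc n) := fun m => {x | f x / b ≤ m + 1} ∩ Metric.ball 0 (m + 1) with hE
  have hEm : ∀ m, MeasurableSet (E m) := fun m =>
    (measurableSet_le (hf.div_const b) measurable_const).inter measurableSet_ball
  have hmono : Monotone E := by
    intro i j hij x hx
    have hij' : (i : ℝ) ≤ j := by exact_mod_cast hij
    have hij'' : (i : ℝ≥0∞) ≤ j := by exact_mod_cast hij
    exact ⟨le_trans hx.1 (add_le_add_left hij'' 1), Metric.ball_subset_ball (by linarith) hx.2⟩
  have hU : (⋃ m, E m) = univ := by
    refine eq_univ_of_forall fun x => mem_iUnion.2 ?_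
    obtain ⟨i, hi⟩ := ENNReal.exists_nat_gt (ENNReal.div_ne_top (hf' x) hb0)
    obtain ⟨j, hj⟩ := exists_nat_gt (dist x 0)
    have hi' : (i : ℝ≥0∞) ≤ (max i j : ℕ) := by exact_mod_cast le_max_left i j
    have hj' : (j : ℝ) ≤ (max i j : ℕ) := by exact_mod_cast le_max_right i j
    exact ⟨max i j, hi.le.trans (hi'.trans le_self_add),
      Metric.mem_ball.2 (by linarith)⟩
  rw [← setLIntegral_univ, ← hU,
    setLIntegral_iUnion_of_directed _ hmono.directed_le, lt_iSup_iff] at h1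
  obtain ⟨m, hm⟩ := h1
  set I := ∫⁻ x in E m, (f x / b) ^ t x with hI
  have hItop : I ≠ ∞ := by
    refine (lt_of_le_of_lt (b := ∫⁻ _ in E m, ((m : ℝ≥0∞) + 1) ^ tb) ?_ ?_).ne
    · refine setLIntegral_mono measurable_const fun x hx => ?_
      exact (ENNReal.rpow_le_rpow hx.1 (htr x).pos.le).trans
        (ENNReal.rpow_le_rpow_of_exponent_le le_add_self (htb x))
    · rw [setLIntegral_const]
      refine ENNReal.mul_lt_top (ENNReal.rpow_lt_top_of_nonneg
        ((htr 0).pos.le.trans (htb 0)) (by finiteness)) ?_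
      exact (measure_mono inter_subset_right).trans_lt measure_ball_lt_top
  have hI0 : I ≠ 0 := (zero_lt_one.trans hm).ne'
  have hHm : Measurable fun x => (f x / b) ^ (t x - 1) :=
    (hf.div_const b).pow (ht.sub_const 1)
  refine ⟨(E m).indicator fun x => (f x / b) ^ (t x - 1) / I,
    (hHm.div_const I).indicator (hEm m), ?_, ?_, ?_⟩
  · refine varNorm_le one_pos ENNReal.one_ne_top ?_
    calc ∫⁻ x, ((E m).indicator (fun x => (f x / b) ^ (t x - 1) / I) x / 1) ^ r x
        ≤ ∫⁻ x, (E m).indicator (fun x => I⁻¹ * (f x / b) ^ t x) x := by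
          refine lintegral_mono fun x => ?_
          by_cases hx : x ∈ E m
          · rw [indicator_of_mem hx, indicator_of_mem hx, div_one,
              ENNReal.div_rpow_of_nonneg _ _ (htr x).symm.nonneg, ← ENNReal.rpow_mul,
              (htr x).sub_one_mul_conj, div_eq_mul_inv, mul_comm, ← ENNReal.inv_rpow]
            gcongr
            calc I⁻¹ ^ r x ≤ I⁻¹ ^ (1 : ℝ) :=
                  ENNReal.rpow_le_rpow_of_exponent_ge (ENNReal.inv_le_one.2 hm.le)
                    (htr x).symm.lt.le
              _ = I⁻¹ := ENNReal.rpow_one _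
          · simp [hx, (htr x).symm.pos]
      _ = I⁻¹ * I := by
          rw [lintegral_indicator (hEm m), lintegral_const_mul' _ _ (ENNReal.inv_ne_top.2 hI0)]
      _ ≤ 1 := ENNReal.inv_mul_le_one I
  · intro x hx
    have : 0 < t x - 1 := sub_pos.2 (htr x).lt
    by_cases hxE : x ∈ E m <;> simp [hxE, hx, this]
  · refine le_of_eq ?_
    calc b = b / I * I := (ENNReal.div_mul_cancel hI0 hItop).symm
      _ = ∫⁻ x in E m, b / I * (f x / b) ^ t x := by
          rw [lintegral_const_mul' _ _ (ENNReal.div_ne_top hb1 hI0)]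
      _ = ∫⁻ x, f x * (E m).indicator (fun x => (f x / b) ^ (t x - 1) / I) x := by
          rw [← lintegral_indicator (hEm m)]
          refine lintegral_congr fun x => ?_
          by_cases hx : x ∈ E m
          · rw [indicator_of_mem hx, indicator_of_mem hx]
            have hpow : (f x / b) ^ t x = f x / b * (f x / b) ^ (t x - 1) := by
              have h2 : 0 < t x - 1 := sub_pos.2 (htr x).lt
              nth_rewrite 2 [← ENNReal.rpow_one (f x / b)]
              rw [← ENNReal.rpow_add_of_nonneg _ _ zero_le_one h2.le]
              congr 1; ring
            have hfb : f x = f x / b * b := (ENNReal.div_mul_cancel hb0 hb1).symm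
            rw [hpow]
            nth_rewrite 3 [hfb]
            simp only [div_eq_mul_inv]
            ring
          · simp [hx]

theorem average_rpow_le (f : Euc n → ℝ≥0∞) (hf : Measurable f) {m : ℝ} (hm : 1 ≤ m) (c : Euc n)
    {ρ : ℝ} (hρ : 0 < ρ) :
    ((volume (Metric.ball c ρ))⁻¹ * ∫⁻ y in Metric.ball c ρ, f y) ^ m ≤
      (volume (Metric.ball c ρ))⁻¹ * ∫⁻ y in Metric.ball c ρ, f y ^ m := by
  have h0 := (volume_ball_pos c hρ).ne'
  have h1 : volume (Metric.ball c ρ) ≠ ∞ := measure_ball_lt_top.ne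
  have h := lintegral_rpow_le_measure_univ_mul (volume.restrict (Metric.ball c ρ)) hm
    hf.aemeasurable
  rw [Measure.restrict_apply_univ] at h
  rw [ENNReal.mul_rpow_of_nonneg _ _ (by linarith)]
  calc (volume (Metric.ball c ρ))⁻¹ ^ m * (∫⁻ y in Metric.ball c ρ, f y) ^ m
      ≤ (volume (Metric.ball c ρ))⁻¹ ^ m * (volume (Metric.ball c ρ) ^ (m - 1) *
          ∫⁻ y in Metric.ball c ρ, f y ^ m) := by gcongr
    _ = _ := by
      rw [← mul_assoc]
      congr 1
      rw [ENNReal.inv_rpow, ← ENNReal.rpow_neg, ← ENNReal.rpow_add _ _ h0 h1,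
        ← ENNReal.rpow_neg_one]
      congr 1; ring

theorem one_le_log_exp_add {y : ℝ} (hy : 0 ≤ y) : 1 ≤ Real.log (Real.exp 1 + y) := by
  rw [Real.le_log_iff_exp_le (by positivity)]
  linarith

theorem inv_volume_ball_rpow_le {D : ℝ} (hD : 0 ≤ D) :
    ∃ C₁ : ℝ≥0∞, 1 ≤ C₁ ∧ C₁ < ∞ ∧ ∀ (c : Euc n) (ρ : ℝ), 0 < ρ →
      (volume (Metric.ball c ρ))⁻¹ ^ (D / Real.log (Real.exp 1 + 1 / (2 * ρ))) ≤ C₁ := by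
  set v := (volume (Metric.ball (0 : Euc n) 1)).toReal with hv
  have hvtop : volume (Metric.ball (0 : Euc n) 1) ≠ ∞ := measure_ball_lt_top.ne
  have hv0 : 0 < v := ENNReal.toReal_pos (volume_ball_pos 0 one_pos).ne' hvtop
  set L := |Real.log (2 ^ n / v)| with hL
  refine ⟨ENNReal.ofReal (Real.exp (D * (L + n))), ?_, ENNReal.ofReal_lt_top, ?_⟩
  · rw [ENNReal.one_le_ofReal]
    exact Real.one_le_exp (by positivity)
  intro c ρ hρ
  have hball : volume (Metric.ball c ρ) = ENNReal.ofReal (ρ ^ n * v) := by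
    rw [volume_ball_eq c hρ, ENNReal.ofReal_mul (by positivity), hv, ENNReal.ofReal_toReal hvtop]
  have hpos : 0 < ρ ^ n * v := by positivity
  set ℓ := Real.log (Real.exp 1 + 1 / (2 * ρ)) with hℓ
  have hℓ1 : 1 ≤ ℓ := one_le_log_exp_add (by positivity)
  rw [hball, ← ENNReal.ofReal_inv_of_pos hpos, ENNReal.ofReal_rpow_of_pos (by positivity)]
  refine ENNReal.ofReal_le_ofReal ?_
  rw [Real.rpow_def_of_pos (by positivity), Real.exp_le_exp]
  have h1 : Real.log (ρ ^ n * v)⁻¹ ≤ L + n * ℓ := by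
    have : (ρ ^ n * v)⁻¹ = 2 ^ n / v * (1 / (2 * ρ)) ^ n := by
      rw [div_pow, mul_pow, one_pow]; field_simp
    rw [this, Real.log_mul (by positivity) (by positivity), Real.log_pow]
    refine add_le_add (le_abs_self _) ?_
    refine mul_le_mul_of_nonneg_left (Real.log_le_log (by positivity) ?_) (by positivity)
    linarith [Real.exp_pos 1]
  calc Real.log (ρ ^ n * v)⁻¹ * (D / ℓ) ≤ (L + n * ℓ) * (D / ℓ) := by gcongr
    _ = D * (L / ℓ + n) := by field_simp
    _ ≤ D * (L + n) := by gcongr; exact div_le_self (abs_nonneg _) hℓ1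

/-- Pointwise estimate for the maximal function of a function with values in `{0} ∪ [1, ∞]`
and integral at most `1`, from local log-Hölder continuity. -/
theorem maximalFn_rpow_le_of_local {D : ℝ} (hD : 0 ≤ D) :
    ∃ C₁ : ℝ≥0∞, C₁ < ∞ ∧ ∀ p : Euc n → ℝ, Measurable p → (∀ x, 1 ≤ p x) →
      (∀ x y : Euc n, x ≠ y → |p x - p y| ≤ D / Real.log (Real.exp 1 + 1 / dist x y)) →
      ∀ f : Euc n → ℝ≥0∞, Measurable f → (∀ x, f x = 0 ∨ 1 ≤ f x) → ∫⁻ x, f x ≤ 1 →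
      ∀ x, maximalFn f x ^ p x ≤ C₁ * maximalFn (fun y => f y ^ p y) x := by
  obtain ⟨C₁, hC1, hCtop, hC⟩ := inv_volume_ball_rpow_le (n := n) hD
  refine ⟨C₁, hCtop, fun p hpm hp hlog f hf hf1 hint x => ?_⟩
  have hpx : 0 < p x := by linarith [hp x]
  rw [← ENNReal.le_rpow_inv_iff hpx]
  refine maximalFn_le_iff.2 fun c ρ hρ hx => ?_
  rw [ENNReal.le_rpow_inv_iff hpx]
  refine le_trans ?_ (mul_le_mul_right (maximalFn_ge _ hρ hx) C₁)
  set A := (volume (Metric.ball c ρ))⁻¹ * ∫⁻ y in Metric.ball c ρ, f y with hA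
  set δ := D / Real.log (Real.exp 1 + 1 / (2 * ρ)) with hδ
  have hδ0 : 0 ≤ δ := div_nonneg hD (zero_le_one.trans (one_le_log_exp_add (by positivity)))
  set m := max 1 (p x - δ) with hm
  have hm1 : 1 ≤ m := le_max_left _ _
  have hmx : m ≤ p x := max_le (hp x) (by linarith)
  have hmδ : p x - m ≤ δ := by linarith [le_max_right 1 (p x - δ)]
  have hmy : ∀ y ∈ Metric.ball c ρ, m ≤ p y := by
    intro y hy
    refine max_le (hp y) ?_
    rcases eq_or_ne x y with rfl | hxy
    · linarith
    have hd : 0 < dist x y := dist_pos.2 hxy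
    have hd2 : dist x y ≤ 2 * ρ := by
      have := dist_triangle_right x y c
      rw [Metric.mem_ball] at hx hy
      linarith
    have h1 : |p x - p y| ≤ δ := by
      refine (hlog x y hxy).trans ?_
      have h3 := one_le_log_exp_add (y := 1 / (2 * ρ)) (by positivity)
      exact div_le_div_of_nonneg_left hD (by linarith) (Real.log_le_log (by positivity)
        (by linarith [one_div_le_one_div_of_le hd hd2]))
    linarith [le_abs_self (p x - p y)]
  have hAle : A ≤ (volume (Metric.ball c ρ))⁻¹ := by
    calc A ≤ (volume (Metric.ball c ρ))⁻¹ * 1 := by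
          exact mul_le_mul_right ((setLIntegral_le_lintegral _ _).trans hint) _
      _ = _ := mul_one _
  have hAexp : A ^ (p x - m) ≤ C₁ := by
    rcases le_total A 1 with h | h
    · exact (ENNReal.rpow_le_one h (by linarith)).trans hC1
    · calc A ^ (p x - m) ≤ A ^ δ := ENNReal.rpow_le_rpow_of_exponent_le h hmδ
        _ ≤ (volume (Metric.ball c ρ))⁻¹ ^ δ := ENNReal.rpow_le_rpow hAle hδ0
        _ ≤ C₁ := hC c ρ hρ
  calc A ^ p x = A ^ (p x - m) * A ^ m := by
        rw [← ENNReal.rpow_add_of_nonneg _ _ (by linarith) (by linarith)]; congr 1; ring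
    _ ≤ C₁ * ((volume (Metric.ball c ρ))⁻¹ * ∫⁻ y in Metric.ball c ρ, f y ^ m) := by
        gcongr
        exact average_rpow_le f hf hm1 c hρ
    _ ≤ C₁ * ((volume (Metric.ball c ρ))⁻¹ * ∫⁻ y in Metric.ball c ρ, f y ^ p y) := by
        gcongr 2
        refine setLIntegral_mono (hf.pow hpm) fun y hy => ?_
        rcases hf1 y with h | h
        · rw [h, ENNReal.zero_rpow_of_pos (by linarith)]; exact zero_le
        · exact ENNReal.rpow_le_rpow_of_exponent_le h (hmy y hy)

theorem rpow_le_mul_rpow_add_of_decay {C N y α β : ℝ} (hN : 0 ≤ N) (hy : 0 ≤ y) (hβ : 1 ≤ β)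
    (h : |α - β| ≤ C / Real.log (Real.exp 1 + y)) {u : ℝ≥0∞} (hu : u ≤ 1) :
    u ^ β ≤ ENNReal.ofReal (Real.exp (N * C)) * u ^ α +
      ENNReal.ofReal ((Real.exp 1 + y) ^ (-N)) := by
  have hey : 0 < Real.exp 1 + y := by positivity
  have hl : 1 ≤ Real.log (Real.exp 1 + y) := one_le_log_exp_add hy
  rcases le_or_gt u (ENNReal.ofReal ((Real.exp 1 + y) ^ (-N))) with hle | hlt
  · refine le_trans ?_ le_add_self
    calc u ^ β ≤ u ^ (1 : ℝ) := ENNReal.rpow_le_rpow_of_exponent_ge hu hβ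
      _ = u := ENNReal.rpow_one u
      _ ≤ _ := hle
  · refine le_trans ?_ le_self_add
    have hu0 : u ≠ 0 := (zero_le.trans_lt hlt).ne'
    have hu1 : u ≠ ∞ := (hu.trans_lt ENNReal.one_lt_top).ne
    have hsplit : u ^ β = u ^ (β - α) * u ^ α := by
      rw [← ENNReal.rpow_add _ _ hu0 hu1]; congr 1; ring
    rw [hsplit]
    gcongr
    calc u ^ (β - α) ≤ u ^ (-|α - β|) :=
          ENNReal.rpow_le_rpow_of_exponent_ge hu (by linarith [le_abs_self (α - β)])
      _ ≤ ENNReal.ofReal ((Real.exp 1 + y) ^ (-N)) ^ (-|α - β|) := by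
          rw [ENNReal.rpow_neg, ENNReal.rpow_neg]
          exact ENNReal.inv_le_inv.2 (ENNReal.rpow_le_rpow hlt.le (abs_nonneg _))
      _ ≤ ENNReal.ofReal (Real.exp (N * C)) := by
          rw [ENNReal.ofReal_rpow_of_pos (by positivity)]
          refine ENNReal.ofReal_le_ofReal ?_
          rw [← Real.rpow_mul hey.le, neg_mul_neg, Real.rpow_def_of_pos hey, Real.exp_le_exp]
          rw [le_div_iff₀ (by linarith)] at h
          nlinarith

theorem lintegral_exp_one_add_norm_rpow_lt_top (n : ℕ) :
    ∫⁻ x : Euc n, ENNReal.ofReal ((Real.exp 1 + ‖x‖) ^ (-((n : ℝ) + 1))) < ∞ := by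
  refine lt_of_le_of_lt (lintegral_mono fun x => ?_)
    (finite_integral_one_add_norm (E := Euc n) (μ := volume) (r := (n : ℝ) + 1) (by simp))
  refine ENNReal.ofReal_le_ofReal (Real.rpow_le_rpow_of_nonpos (by positivity) ?_ ?_)
  · linarith [Real.add_one_le_exp 1]
  · linarith [n.cast_nonneg (α := ℝ)]

theorem le_of_logDecay (hn : 0 < n) {r : Euc n → ℝ} {a C rinf : ℝ} (hC : 0 < C)
    (ha : ∀ x, a ≤ r x)
    (h : ∀ x : Euc n, |r x - rinf| ≤ C / Real.log (Real.exp 1 + ‖x‖)) : a ≤ rinf := by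
  by_contra hlt
  have hη : 0 < a - rinf := sub_pos.2 (not_le.1 hlt)
  set t := Real.exp (C / (a - rinf) + 1) with ht
  set x : Euc n := EuclideanSpace.single ⟨0, hn⟩ t with hx
  have hnorm : ‖x‖ = t := by
    rw [hx, PiLp.norm_single, Real.norm_of_nonneg (Real.exp_pos _).le]
  have h1 := h x
  rw [hnorm] at h1
  have hlog : C / (a - rinf) < Real.log (Real.exp 1 + t) := by
    rw [Real.lt_log_iff_exp_lt (by positivity)]
    calc Real.exp (C / (a - rinf)) < t := Real.exp_lt_exp.2 (by linarith)
      _ < Real.exp 1 + t := by linarith [Real.exp_pos 1]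
  have h2 : C / Real.log (Real.exp 1 + t) < a - rinf := by
    have : 0 < C / (a - rinf) := by positivity
    rw [div_lt_iff₀ (this.trans hlog), mul_comm, ← div_lt_iff₀ hη]
    exact hlog
  linarith [ha x, le_abs_self (r x - rinf)]

/-- The modular form of the boundedness of the maximal operator on `L^{r(·)}` for log-Hölder
exponents bounded away from `1` and `∞`. -/
theorem exists_lintegral_maximalFn_rpow_varExp_le (hn : 0 < n) {r : Euc n → ℝ}
    (hrm : Measurable r) {a b : ℝ} (ha : 1 < a) (hra : ∀ x, a ≤ r x) (hrb : ∀ x, r x ≤ b)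
    (hlog : LogHolder r) :
    ∃ K : ℝ≥0∞, 1 ≤ K ∧ K < ∞ ∧ ∀ f : Euc n → ℝ≥0∞, Measurable f →
      ∫⁻ x, f x ^ r x ≤ 1 → ∫⁻ x, maximalFn f x ^ r x ≤ K := by
  obtain ⟨C, hC, rinf, hloc, hdec⟩ := hlog
  have hrinf : a ≤ rinf := le_of_logDecay hn hC hra hdec
  obtain ⟨C₁, hC₁, hpt⟩ := maximalFn_rpow_le_of_local (n := n) hC.le
  obtain ⟨K₁, hK₁, hM₁⟩ := exists_lintegral_maximalFn_rpow_le hn ha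
  obtain ⟨K₂, hK₂, hM₂⟩ := exists_lintegral_maximalFn_rpow_le hn (ha.trans_le hrinf)
  have hW := lintegral_exp_one_add_norm_rpow_lt_top n
  set W := ∫⁻ x : Euc n, ENNReal.ofReal ((Real.exp 1 + ‖x‖) ^ (-((n : ℝ) + 1))) with hWdef
  set E := ENNReal.ofReal (Real.exp (((n : ℝ) + 1) * C)) with hE
  have hEtop : E ≠ ∞ := ENNReal.ofReal_ne_top
  have ha0 : 0 < a := by linarith
  have hr0 : ∀ x, 0 < r x := fun x => ha0.trans_le (hra x)
  have hb0 : 0 < b := (hr0 0).trans_le (hrb 0)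
  have hfin : 2 ^ b * (C₁ ^ a * K₁ + (E * (K₂ * (E + W)) + W)) < ∞ := by
    have h2 : (2 : ℝ≥0∞) ^ b ≠ ∞ := two_rpow_ne_top b
    have hCa : C₁ ^ a ≠ ∞ := ENNReal.rpow_ne_top_of_nonneg ha0.le hC₁.ne
    have := hW.ne
    have := hK₁.ne
    have := hK₂.ne
    finiteness
  refine ⟨max 1 (2 ^ b * (C₁ ^ a * K₁ + (E * (K₂ * (E + W)) + W))), le_max_left _ _,
    max_lt ENNReal.one_lt_top hfin, fun f hf hint => le_trans ?_ (le_max_right _ _)⟩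
  have hS : MeasurableSet {x | 1 ≤ f x} := measurableSet_le measurable_const hf
  set f₁ := {x | 1 ≤ f x}.indicator f with hf₁
  set f₂ := {x | 1 ≤ f x}ᶜ.indicator f with hf₂
  have hf₁m : Measurable f₁ := hf.indicator hS
  have hf₂m : Measurable f₂ := hf.indicator hS.compl
  have hint₁ : ∫⁻ x, f₁ x ^ r x ≤ 1 := (lintegral_mono fun x =>
    ENNReal.rpow_le_rpow (indicator_le_self _ _ x) (hr0 x).le).trans hint
  have hint₂ : ∫⁻ x, f₂ x ^ r x ≤ 1 := (lintegral_mono fun x =>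
    ENNReal.rpow_le_rpow (indicator_le_self _ _ x) (hr0 x).le).trans hint
  have hf₁1 : ∀ x, f₁ x = 0 ∨ 1 ≤ f₁ x := by
    intro x
    by_cases hx : 1 ≤ f x
    · right; rwa [hf₁, indicator_of_mem (show x ∈ {x | 1 ≤ f x} from hx)]
    · left; exact indicator_of_notMem (show x ∉ {x | 1 ≤ f x} from hx) f
  have hf₂1 : ∀ x, f₂ x ≤ 1 := by
    intro x
    by_cases hx : 1 ≤ f x
    · rw [hf₂, indicator_of_notMem (show x ∉ {x | 1 ≤ f x}ᶜ from fun h => h hx)]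
      exact zero_le
    · exact (indicator_le_self _ _ x).trans (not_le.1 hx).le
  have hmain₁ : ∫⁻ x, maximalFn f₁ x ^ r x ≤ C₁ ^ a * K₁ := by
    have hp : ∀ x, 1 ≤ r x / a := fun x => (one_le_div ha0).2 (hra x)
    have hpoint := hpt (fun x => r x / a) (hrm.div_const a) hp (fun x y hxy => by
      rw [← sub_div, abs_div, abs_of_pos ha0]
      exact (div_le_self (abs_nonneg _) ha.le).trans (hloc x y hxy)) f₁ hf₁m hf₁1
      ((lintegral_mono fun x => by
        rcases hf₁1 x with h | h
        · rw [h]; exact zero_le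
        · calc f₁ x = f₁ x ^ (1 : ℝ) := (ENNReal.rpow_one _).symm
            _ ≤ f₁ x ^ r x :=
              ENNReal.rpow_le_rpow_of_exponent_le h (ha.le.trans (hra x))).trans hint₁)
    calc ∫⁻ x, maximalFn f₁ x ^ r x
        ≤ ∫⁻ x, C₁ ^ a * maximalFn (fun y => f₁ y ^ (r y / a)) x ^ a := by
          refine lintegral_mono fun x => ?_
          rw [← ENNReal.mul_rpow_of_nonneg _ _ ha0.le]
          calc maximalFn f₁ x ^ r x = (maximalFn f₁ x ^ (r x / a)) ^ a := by
                rw [← ENNReal.rpow_mul, div_mul_cancel₀ _ ha0.ne']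
            _ ≤ _ := ENNReal.rpow_le_rpow (hpoint x) ha0.le
      _ = C₁ ^ a * ∫⁻ x, maximalFn (fun y => f₁ y ^ (r y / a)) x ^ a :=
          lintegral_const_mul' _ _ (ENNReal.rpow_ne_top_of_nonneg ha0.le hC₁.ne)
      _ ≤ C₁ ^ a * (K₁ * ∫⁻ x, (f₁ x ^ (r x / a)) ^ a) := by
          gcongr
          exact hM₁ _ (hf₁m.pow (hrm.div_const a))
      _ ≤ C₁ ^ a * (K₁ * 1) := by
          gcongr
          refine le_trans (le_of_eq (lintegral_congr fun x => ?_)) hint₁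
          rw [← ENNReal.rpow_mul, div_mul_cancel₀ _ ha0.ne']
      _ = C₁ ^ a * K₁ := by rw [mul_one]
  have hWm : Measurable fun x : Euc n =>
      ENNReal.ofReal ((Real.exp 1 + ‖x‖) ^ (-((n : ℝ) + 1))) := by fun_prop
  have hN : (0 : ℝ) ≤ (n : ℝ) + 1 := by positivity
  have hmain₂ : ∫⁻ x, maximalFn f₂ x ^ r x ≤ E * (K₂ * (E + W)) + W := by
    calc ∫⁻ x, maximalFn f₂ x ^ r x
        ≤ ∫⁻ x, (E * maximalFn f₂ x ^ rinf +
            ENNReal.ofReal ((Real.exp 1 + ‖x‖) ^ (-((n : ℝ) + 1)))) := by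
          refine lintegral_mono fun x => ?_
          refine rpow_le_mul_rpow_add_of_decay hN (norm_nonneg x) (ha.le.trans (hra x)) ?_
            (maximalFn_le_const hf₂1 x)
          rw [abs_sub_comm]; exact hdec x
      _ = E * (∫⁻ x, maximalFn f₂ x ^ rinf) + W := by
          rw [lintegral_add_right _ hWm, lintegral_const_mul' _ _ hEtop]
      _ ≤ E * (K₂ * ∫⁻ x, f₂ x ^ rinf) + W := by
          gcongr
          exact hM₂ _ hf₂m
      _ ≤ E * (K₂ * (E + W)) + W := by
          gcongr
          calc ∫⁻ x, f₂ x ^ rinf ≤ ∫⁻ x, (E * f₂ x ^ r x +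
                ENNReal.ofReal ((Real.exp 1 + ‖x‖) ^ (-((n : ℝ) + 1)))) :=
                lintegral_mono fun x => rpow_le_mul_rpow_add_of_decay hN (norm_nonneg x)
                  (ha.le.trans hrinf) (hdec x) (hf₂1 x)
            _ = E * (∫⁻ x, f₂ x ^ r x) + W := by
                rw [lintegral_add_right _ hWm, lintegral_const_mul' _ _ hEtop]
            _ ≤ E * 1 + W := by gcongr
            _ = E + W := by rw [mul_one]
  have hle : ∀ x, maximalFn f x ≤ maximalFn f₁ x + maximalFn f₂ x := by
    intro x
    refine le_trans (maximalFn_mono (.of_forall fun y => ?_) x) (maximalFn_add_le f₁ f₂ hf₁m x)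
    exact (indicator_self_add_compl_apply {x | 1 ≤ f x} f y).ge
  calc ∫⁻ x, maximalFn f x ^ r x
      ≤ ∫⁻ x, 2 ^ b * (maximalFn f₁ x ^ r x + maximalFn f₂ x ^ r x) := by
        refine lintegral_mono fun x => ?_
        have hmax : maximalFn f x ≤ 2 * max (maximalFn f₁ x) (maximalFn f₂ x) := by
          rw [two_mul]
          exact (hle x).trans (add_le_add (le_max_left _ _) (le_max_right _ _))
        refine (ENNReal.rpow_le_rpow hmax (hr0 x).le).trans ?_
        rw [ENNReal.mul_rpow_of_nonneg _ _ (hr0 x).le]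
        refine mul_le_mul' (ENNReal.rpow_le_rpow_of_exponent_le (by norm_num) (hrb x)) ?_
        rcases le_total (maximalFn f₁ x) (maximalFn f₂ x) with h | h
        · rw [max_eq_right h]; exact le_add_self
        · rw [max_eq_left h]; exact le_self_add
    _ = 2 ^ b * ((∫⁻ x, maximalFn f₁ x ^ r x) + ∫⁻ x, maximalFn f₂ x ^ r x) := by
        rw [lintegral_const_mul' _ _ (two_rpow_ne_top b),
          lintegral_add_left ((measurable_maximalFn f₁).pow hrm)]
    _ ≤ _ := by gcongr

theorem exists_varNorm_maximalFn_le (hn : 0 < n) {r : Euc n → ℝ}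
    (hrm : Measurable r) {a b : ℝ} (ha : 1 < a) (hra : ∀ x, a ≤ r x) (hrb : ∀ x, r x ≤ b)
    (hlog : LogHolder r) :
    ∃ K : ℝ≥0∞, 1 ≤ K ∧ K < ∞ ∧ ∀ f : Euc n → ℝ≥0∞, Measurable f →
      varNorm r (maximalFn f) ≤ K * varNorm r f := by
  obtain ⟨K, hK1, hKtop, hK⟩ := exists_lintegral_maximalFn_rpow_varExp_le hn hrm ha hra hrb hlog
  refine ⟨K, hK1, hKtop, fun f hf => ?_⟩
  refine le_mul_varNorm (zero_lt_one.trans_le hK1).ne' hKtop.ne fun c hc0 hc1 hc => ?_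
  refine varNorm_le_mul_of_lintegral_le (fun x => ha.le.trans (hra x)) hc0 hc1 hK1 hKtop.ne ?_
  have h := hK (fun x => f x / c) (hf.div_const c) hc
  refine le_trans (le_of_eq (lintegral_congr fun x => ?_)) h
  congr 1
  simp only [div_eq_mul_inv, mul_comm _ c⁻¹]
  exact (maximalFn_const_mul c⁻¹ hf x).symm

theorem volume_ball_two_zpow (k : ℤ) : volume (Metric.ball (0 : Euc n) ((2 : ℝ) ^ k)) =
    (2 : ℝ≥0∞) ^ ((k : ℝ) * n) * volume (Metric.ball (0 : Euc n) 1) := by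
  rw [volume_ball_eq _ (zpow_pos two_pos k), Real.rpow_intCast 2 k |>.symm, ← Real.rpow_natCast,
    ← Real.rpow_mul zero_le_two, ← ENNReal.ofReal_rpow_of_pos two_pos, ENNReal.ofReal_ofNat]

theorem volume_ball_two_zpow_div (j k : ℤ) : volume (Metric.ball (0 : Euc n) ((2 : ℝ) ^ j)) /
      volume (Metric.ball (0 : Euc n) ((2 : ℝ) ^ k)) =
    (2 : ℝ≥0∞) ^ (((j : ℝ) - k) * n) := by
  rw [volume_ball_two_zpow, volume_ball_two_zpow,
    ENNReal.mul_div_mul_right _ _ (volume_ball_pos 0 one_pos).ne' measure_ball_lt_top.ne,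
    ← ENNReal.rpow_sub _ _ two_ne_zero ENNReal.ofNat_ne_top, sub_mul]

theorem LogHolder.continuous {q : Euc n → ℝ} (h : LogHolder q) : Continuous q := by
  obtain ⟨C, hC, _, hloc, -⟩ := h
  rw [continuous_iff_continuousAt]
  intro x
  rw [ContinuousAt, Metric.tendsto_nhds]
  intro ε hε
  have hsmall : ∀ᶠ y in 𝓝 x, dist x y < Real.exp (-(C / ε)) := by
    filter_upwards [Metric.ball_mem_nhds x (Real.exp_pos (-(C / ε)))] with y hy
    rwa [dist_comm]
  filter_upwards [hsmall] with y hy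
  rcases eq_or_ne x y with rfl | hxy
  · simpa using hε
  have hd : 0 < dist x y := dist_pos.2 hxy
  rw [dist_comm, Real.dist_eq]
  refine (hloc x y hxy).trans_lt ?_
  have hlog : C / ε < Real.log (Real.exp 1 + 1 / dist x y) := by
    rw [Real.lt_log_iff_exp_lt (by positivity)]
    have : Real.exp (C / ε) < 1 / dist x y := by
      rw [lt_div_iff₀ hd, ← lt_div_iff₀' (Real.exp_pos _), one_div, ← Real.exp_neg]
      exact hy
    linarith [Real.exp_pos 1]
  have : 0 < C / ε := by positivity
  rw [div_lt_iff₀ (this.trans hlog), mul_comm, ← div_lt_iff₀ hε]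
  exact hlog

theorem forall_of_ae_bounds {q : Euc n → ℝ} (hq : Continuous q) {a b : ℝ}
    (h : ∀ᵐ x ∂(volume : Measure (Euc n)), a ≤ q x ∧ q x ≤ b) (x : Euc n) :
    a ≤ q x ∧ q x ≤ b := by
  have hcl : IsClosed {x | a ≤ q x ∧ q x ≤ b} :=
    (isClosed_le continuous_const hq).inter (isClosed_le hq continuous_const)
  have hd : Dense {x | a ≤ q x ∧ q x ≤ b} := Measure.dense_of_ae h
  have : x ∈ closure {x | a ≤ q x ∧ q x ≤ b} := hd x
  rwa [hcl.closure_eq] at this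

/-- The pointwise conjugate of `q / s` is log-Hölder continuous. -/
theorem LogHolder.conjExponent (hn : 0 < n) {q : Euc n → ℝ} (h : LogHolder q) {s qm : ℝ}
    (hs : 0 < s) (hqm : s < qm) (hq : ∀ x, qm ≤ q x) :
    LogHolder (fun x => q x / (q x - s)) := by
  obtain ⟨C, hC, qinf, hloc, hdec⟩ := h
  have hinf : qm ≤ qinf := le_of_logDecay hn hC hq hdec
  have hd : 0 < qm - s := sub_pos.2 hqm
  have key : ∀ u v : ℝ, qm ≤ u → qm ≤ v →
      |u / (u - s) - v / (v - s)| ≤ s / (qm - s) ^ 2 * |u - v| := by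
    intro u v hu hv
    have hu' : 0 < u - s := by linarith
    have hv' : 0 < v - s := by linarith
    have : u / (u - s) - v / (v - s) = s / ((u - s) * (v - s)) * -(u - v) := by
      field_simp; ring
    rw [this, abs_mul, abs_neg, abs_of_pos (by positivity)]
    refine mul_le_mul_of_nonneg_right ?_ (abs_nonneg _)
    refine div_le_div_of_nonneg_left hs.le (by positivity) ?_
    rw [sq]
    gcongr
  refine ⟨s / (qm - s) ^ 2 * C, by positivity, qinf / (qinf - s), fun x y hxy => ?_, fun x => ?_⟩
  · rw [mul_div_assoc]
    exact (key _ _ (hq x) (hq y)).trans (mul_le_mul_of_nonneg_left (hloc x y hxy) (by positivity))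
  · rw [mul_div_assoc]
    exact (key _ _ (hq x) hinf).trans (mul_le_mul_of_nonneg_left (hdec x) (by positivity))

/-- The Muckenhoupt-type condition on balls for conjugate exponents, from boundedness of the
maximal operator. -/
theorem varNorm_ball_mul_varNorm_ball_le {t r : Euc n → ℝ} (ht : Measurable t) {tb : ℝ}
    (htr : ∀ x, (t x).HolderConjugate (r x)) (htb : ∀ x, t x ≤ tb)
    {K : ℝ≥0∞} (hK1 : 1 ≤ K) (hK : ∀ f : Euc n → ℝ≥0∞, Measurable f →
      varNorm r (maximalFn f) ≤ K * varNorm r f) (c : Euc n) {ρ : ℝ} (hρ : 0 < ρ) :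
    varNorm t ((Metric.ball c ρ).indicator 1) * varNorm r ((Metric.ball c ρ).indicator 1) ≤
      K * volume (Metric.ball c ρ) := by
  set B := Metric.ball c ρ with hB
  have hv0 : volume B ≠ 0 := (volume_ball_pos c hρ).ne'
  have hv1 : volume B ≠ ∞ := measure_ball_lt_top.ne
  have hBm : MeasurableSet B := Metric.isOpen_ball.measurableSet
  have hrm : varNorm r (B.indicator 1) ≠ ∞ :=
    (varNorm_indicator_one_lt_top (fun x => (htr x).symm.lt.le) hBm measure_ball_lt_top).ne
  have hK0 : K * volume B ≠ 0 := mul_ne_zero (zero_lt_one.trans_le hK1).ne' hv0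
  rw [← ENNReal.le_div_iff_mul_le (Or.inr hK0) (Or.inl hrm)]
  refine le_of_forall_lt fun b hb => ?_
  obtain ⟨b', hbb, hb'⟩ := exists_between hb
  refine hbb.trans_le ?_
  rw [ENNReal.le_div_iff_mul_le (Or.inr hK0) (Or.inl hrm)]
  obtain ⟨g, hgm, hg1, -, hg⟩ := exists_le_lintegral_mul ht htr htb
    (measurable_one.indicator hBm) (fun x => by by_cases hx : x ∈ B <;> simp [hx]) hb'
  have hint : b' ≤ ∫⁻ y in B, g y := by
    rw [← lintegral_indicator hBm]
    refine hg.trans (lintegral_mono fun x => ?_)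
    by_cases hx : x ∈ B <;> simp [hx]
  have ha0 : (volume B)⁻¹ * b' ≠ 0 :=
    mul_ne_zero (ENNReal.inv_ne_zero.2 hv1) (zero_le.trans_lt hbb).ne'
  have ha1 : (volume B)⁻¹ * b' ≠ ∞ := ENNReal.mul_ne_top (ENNReal.inv_ne_top.2 hv0) hb'.ne_top
  have h : (volume B)⁻¹ * b' * varNorm r (B.indicator 1) ≤ K := by
    calc (volume B)⁻¹ * b' * varNorm r (B.indicator 1)
        ≤ varNorm r (fun x => (volume B)⁻¹ * b' * B.indicator 1 x) :=
          const_mul_varNorm_le r _ ha0 ha1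
      _ ≤ varNorm r (maximalFn g) := by
          refine varNorm_mono (fun x => (htr x).symm.pos.le) (ae_of_all _ fun x => ?_)
          by_cases hx : x ∈ B
          · simpa [hx] using (mul_le_mul_right hint _).trans (maximalFn_ge g hρ hx)
          · simp [hx]
      _ ≤ K * varNorm r g := hK g hgm
      _ ≤ K * 1 := by gcongr
      _ = K := mul_one K
  calc b' * varNorm r (B.indicator 1)
      = volume B * ((volume B)⁻¹ * b' * varNorm r (B.indicator 1)) := by
        rw [← mul_assoc, ← mul_assoc, ENNReal.mul_inv_cancel hv0 hv1, one_mul]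
    _ ≤ volume B * K := by gcongr
    _ = K * volume B := mul_comm _ _

theorem varNorm_indicator_one_ne_zero {t r : Euc n → ℝ} (ht : Measurable t)
    (htr : ∀ x, (t x).HolderConjugate (r x)) {S : Set (Euc n)} (hS : MeasurableSet S)
    (h0 : volume S ≠ 0) (h1 : volume S < ∞) : varNorm t (S.indicator 1) ≠ 0 := by
  intro h
  have hr := varNorm_indicator_one_lt_top (fun x => (htr x).symm.lt.le) hS h1
  have := lintegral_mul_le_varNorm ht htr (measurable_one.indicator hS)
    (varNorm_indicator_one_lt_top (fun x => (htr x).lt.le) hS h1).ne hr.ne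
  rw [h, mul_zero, nonpos_iff_eq_zero] at this
  refine h0 (le_antisymm (le_trans ?_ this.le) zero_le)
  rw [← lintegral_indicator_one hS]
  refine lintegral_mono fun x => ?_
  by_cases hx : x ∈ S <;> simp [hx]

/-- The dyadic estimate specialised to concentric balls of radii `2 ^ j ≤ 2 ^ k`. -/
theorem varNorm_ball_le_of_dyadic {t : Euc n → ℝ} {C : ℝ≥0∞} {δ : ℝ}
    (ht0 : ∀ k : ℤ, varNorm t ((Metric.ball 0 ((2 : ℝ) ^ k)).indicator 1) ≠ 0)
    (ht1 : ∀ k : ℤ, varNorm t ((Metric.ball 0 ((2 : ℝ) ^ k)).indicator 1) ≠ ∞)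
    (h : ∀ (x : Euc n) (r : ℝ), 0 < r → ∀ E : Set (Euc n), MeasurableSet E →
      E ⊆ Metric.ball x r →
        varNorm t (E.indicator 1) / varNorm t ((Metric.ball x r).indicator 1)
          ≤ C * (volume E / volume (Metric.ball x r)) ^ δ) {j k : ℤ} (hjk : j ≤ k) :
    varNorm t ((Metric.ball 0 ((2 : ℝ) ^ j)).indicator 1) ≤
      C * (2 : ℝ≥0∞) ^ (((j : ℝ) - k) * (n * δ)) *
        varNorm t ((Metric.ball 0 ((2 : ℝ) ^ k)).indicator 1) := by
  have := h 0 _ (zpow_pos two_pos k) _ Metric.isOpen_ball.measurableSet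
    (Metric.ball_subset_ball (zpow_le_zpow_right₀ one_le_two hjk))
  rwa [volume_ball_two_zpow_div, ← ENNReal.rpow_mul, mul_assoc,
    ENNReal.div_le_iff (ht0 k) (ht1 k)] at this

theorem mem_annulus_iff {k : ℤ} {x : Euc n} :
    x ∈ annulus n k ↔ (2 : ℝ) ^ (k - 1) ≤ ‖x‖ ∧ ‖x‖ < (2 : ℝ) ^ k := by
  simp [annulus, and_comm]

theorem exists_mem_annulus {x : Euc n} (hx : x ≠ 0) : ∃ k : ℤ, x ∈ annulus n k := by
  obtain ⟨k, hk1, hk2⟩ := exists_mem_Ico_zpow (norm_pos_iff.2 hx) _root_.one_lt_two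
  exact ⟨k + 1, mem_annulus_iff.2 ⟨by simpa using hk1, hk2⟩⟩

theorem eq_of_mem_annulus {x : Euc n} {j k : ℤ} (hj : x ∈ annulus n j) (hk : x ∈ annulus n k) :
    j = k := by
  rw [mem_annulus_iff] at hj hk
  have h1 := (zpow_lt_zpow_iff_right₀ _root_.one_lt_two).1 (hj.1.trans_lt hk.2)
  have h2 := (zpow_lt_zpow_iff_right₀ _root_.one_lt_two).1 (hk.1.trans_lt hj.2)
  omega

theorem tsum_indicator_annulus (f : Euc n → ℝ≥0∞) {x : Euc n} (hx : x ≠ 0) :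
    ∑' k : ℤ, (annulus n k).indicator f x = f x := by
  obtain ⟨k, hk⟩ := exists_mem_annulus hx
  rw [tsum_eq_single k fun j hj => indicator_of_notMem (fun h => hj (eq_of_mem_annulus h hk)) f,
    indicator_of_mem hk]

theorem ae_ne_zero (hn : 0 < n) : ∀ᵐ x : Euc n, x ≠ 0 := by
  have : Nontrivial (Euc n) := by
    have : Nonempty (Fin n) := ⟨⟨0, hn⟩⟩
    infer_instance
  rw [ae_iff]
  simp

theorem lintegral_eq_tsum_annulus (hn : 0 < n) {f : Euc n → ℝ≥0∞} (hf : Measurable f) :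
    ∫⁻ x, f x = ∑' k : ℤ, ∫⁻ x, (annulus n k).indicator f x := by
  rw [← lintegral_tsum fun k => (hf.indicator (measurableSet_annulus k)).aemeasurable]
  exact lintegral_congr_ae ((ae_ne_zero hn).mono fun x hx => (tsum_indicator_annulus f hx).symm)

theorem maximalFn_indicator_annulus_le (f : Euc n → ℝ≥0∞) {j k : ℤ} (hjk : 2 ≤ |j - k|)
    {x : Euc n} (hx : x ∈ annulus n k) :
    maximalFn ((annulus n j).indicator f) x ≤
      (volume (Metric.ball (0 : Euc n) ((2 : ℝ) ^ (max j k - 3))))⁻¹ *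
        ∫⁻ y, (annulus n j).indicator f y := by
  refine maximalFn_le_iff.2 fun c ρ hρ hxc => ?_
  by_cases h : ∃ y ∈ Metric.ball c ρ, y ∈ annulus n j
  · obtain ⟨y, hyc, hy⟩ := h
    have hdist : dist x y < 2 * ρ := by
      have := dist_triangle_right x y c
      rw [Metric.mem_ball] at hxc hyc
      linarith
    rw [mem_annulus_iff] at hx hy
    rw [dist_eq_norm] at hdist
    have hρ' : (2 : ℝ) ^ (max j k - 3) ≤ ρ := by
      have hz : ∀ m : ℤ, (2 : ℝ) ^ (m - 1) = 4 * 2 ^ (m - 3) ∧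
          (2 : ℝ) ^ (m - 2) = 2 * 2 ^ (m - 3) := fun m => by
        constructor
        · rw [show m - 1 = 2 + (m - 3) by ring, zpow_add₀ two_ne_zero]; norm_num
        · rw [show m - 2 = 1 + (m - 3) by ring, zpow_add₀ two_ne_zero]; norm_num
      rcases le_total j k with hle | hle
      · rw [max_eq_right hle]
        rw [abs_of_nonpos (by omega)] at hjk
        have h1 : (2 : ℝ) ^ j ≤ 2 ^ (k - 2) := zpow_le_zpow_right₀ one_le_two (by omega)
        linarith [(hz k).1, (hz k).2, norm_sub_norm_le x y, hx.1, hy.2]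
      · rw [max_eq_left hle]
        rw [abs_of_nonneg (by omega)] at hjk
        have h1 : (2 : ℝ) ^ k ≤ 2 ^ (j - 2) := zpow_le_zpow_right₀ one_le_two (by omega)
        linarith [(hz j).1, (hz j).2, norm_sub_norm_le y x, norm_sub_rev x y, hy.1, hx.2]
    refine mul_le_mul' (ENNReal.inv_le_inv.2 ?_) (setLIntegral_le_lintegral _ _)
    rw [volume_ball_eq c hρ, volume_ball_eq _ (zpow_pos two_pos _)]
    gcongr
  · push Not at h
    have : ∫⁻ y in Metric.ball c ρ, (annulus n j).indicator f y = 0 := by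
      refine (setLIntegral_congr_fun Metric.isOpen_ball.measurableSet fun y hy => ?_).trans
        (lintegral_zero)
      simp [h y hy]
    rw [this, mul_zero]
    exact zero_le

theorem ENNReal.tsum_le_sum_add_tsum {ι : Type*} {a b : ι → ℝ≥0∞} (s : Finset ι)
    (h : ∀ i ∉ s, a i ≤ b i) : ∑' i, a i ≤ ∑ i ∈ s, a i + ∑' i, b i := by
  classical
  calc ∑' i, a i ≤ ∑' i, ((if i ∈ s then a i else 0) + b i) := by
        refine ENNReal.tsum_le_tsum fun i => ?_
        by_cases hi : i ∈ s
        · simp [hi]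
        · simpa [hi] using h i hi
    _ = ∑ i ∈ s, a i + ∑' i, b i := by
        rw [ENNReal.tsum_add, tsum_eq_sum (s := s) fun i hi => by simp [hi]]
        congr 1
        exact Finset.sum_congr rfl fun i hi => by simp [hi]

/-- On an annulus the maximal function is controlled by its values on neighbouring pieces and a
constant coming from the remote pieces. -/
theorem maximalFn_le_near_add_far (hn : 0 < n) {g : Euc n → ℝ≥0∞} (hg : Measurable g) {k : ℤ}
    {x : Euc n} (hx : x ∈ annulus n k) :
    maximalFn g x ≤ ∑ j ∈ {k - 1, k, k + 1}, maximalFn ((annulus n j).indicator g) x +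
      ∑' j : ℤ, (volume (Metric.ball (0 : Euc n) ((2 : ℝ) ^ (max j k - 3))))⁻¹ *
        ∫⁻ y, (annulus n j).indicator g y := by
  calc maximalFn g x
      ≤ maximalFn (fun y => ∑' j : ℤ, (annulus n j).indicator g y) x :=
        maximalFn_mono ((ae_ne_zero hn).mono fun y hy => (tsum_indicator_annulus g hy).ge) x
    _ ≤ ∑' j : ℤ, maximalFn ((annulus n j).indicator g) x :=
        maximalFn_tsum_le _ (fun j => hg.indicator (measurableSet_annulus j)) x
    _ ≤ _ := by
        refine ENNReal.tsum_le_sum_add_tsum _ fun j hj => ?_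
        refine maximalFn_indicator_annulus_le g ?_ hx
        simp only [Finset.mem_insert, Finset.mem_singleton, not_or] at hj
        rw [le_abs]
        omega

theorem varNorm_const_mul_le' {q : Euc n → ℝ} (hq : ∀ x, 0 < q x) {f : Euc n → ℝ≥0∞}
    (hf : varNorm q f ≠ 0) (a : ℝ≥0∞) : varNorm q (fun x => a * f x) ≤ a * varNorm q f := by
  rcases eq_or_ne a 0 with rfl | h0
  · rw [varNorm_zero hq fun x => zero_mul _]
    exact zero_le
  rcases eq_or_ne a ∞ with rfl | h1
  · rw [ENNReal.top_mul hf]; exact le_top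
  exact varNorm_const_mul_le q f h0 h1

theorem varNorm_annulus_maximalFn_le (hn : 0 < n) {r : Euc n → ℝ} (hr : Measurable r)
    (hr1 : ∀ x, 1 ≤ r x) {K : ℝ≥0∞} (hK : ∀ f : Euc n → ℝ≥0∞, Measurable f →
      varNorm r (maximalFn f) ≤ K * varNorm r f)
    (hB : ∀ k : ℤ, varNorm r ((Metric.ball 0 ((2 : ℝ) ^ k)).indicator 1) ≠ 0)
    {g : Euc n → ℝ≥0∞} (hg : Measurable g) (k : ℤ) :
    varNorm r ((annulus n k).indicator (maximalFn g)) ≤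
      64 * (K * ∑ j ∈ {k - 1, k, k + 1}, varNorm r ((annulus n j).indicator g) +
        ∑' j : ℤ, (volume (Metric.ball (0 : Euc n) ((2 : ℝ) ^ (max j k - 3))))⁻¹ *
          varNorm r ((Metric.ball 0 ((2 : ℝ) ^ k)).indicator 1) *
            ∫⁻ y, (annulus n j).indicator g y) := by
  have hr0 : ∀ x, 0 < r x := fun x => zero_lt_one.trans_le (hr1 x)
  set S := ∑' j : ℤ, (volume (Metric.ball (0 : Euc n) ((2 : ℝ) ^ (max j k - 3))))⁻¹ *
        ∫⁻ y, (annulus n j).indicator g y with hS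
  set B : Set (Euc n) := Metric.ball 0 ((2 : ℝ) ^ k) with hBdef
  have hm : ∀ j, Measurable ((annulus n j).indicator g) :=
    fun j => hg.indicator (measurableSet_annulus j)
  have hMm : ∀ j, Measurable (maximalFn ((annulus n j).indicator g)) :=
    fun j => measurable_maximalFn _
  have hsum : ∀ a : ℤ → ℝ≥0∞, ∑ j ∈ {k - 1, k, k + 1}, a j = a (k - 1) + (a k + a (k + 1)) := by
    intro a
    rw [Finset.sum_insert (by simp; omega), Finset.sum_pair (by omega)]
  set v := varNorm r with hv
  have hbound : v ((annulus n k).indicator (maximalFn g)) ≤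
      v (fun x => maximalFn ((annulus n (k - 1)).indicator g) x +
        (maximalFn ((annulus n k).indicator g) x +
        (maximalFn ((annulus n (k + 1)).indicator g) x + S * B.indicator 1 x))) := by
    refine varNorm_mono (fun x => (hr0 x).le) (ae_of_all _ fun x => ?_)
    by_cases hx : x ∈ annulus n k
    · rw [indicator_of_mem hx]
      refine (maximalFn_le_near_add_far hn hg hx).trans (le_of_eq ?_)
      have hxB : x ∈ B := hx.1
      rw [hsum, ← hS, indicator_of_mem hxB]
      simp [add_assoc]
    · simp [hx]
  have hSB : v (fun x => S * B.indicator 1 x) ≤ ∑' j : ℤ,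
      (volume (Metric.ball (0 : Euc n) ((2 : ℝ) ^ (max j k - 3))))⁻¹ * v (B.indicator 1) *
            ∫⁻ y, (annulus n j).indicator g y := by
    refine (varNorm_const_mul_le' hr0 (hB k) S).trans (le_of_eq ?_)
    rw [hS, ← ENNReal.tsum_mul_right]
    exact tsum_congr fun j => by ring
  refine hbound.trans ?_
  have h1 := varNorm_add_le hr hr1 (hMm (k - 1)) (g := fun x =>
    maximalFn ((annulus n k).indicator g) x +
        (maximalFn ((annulus n (k + 1)).indicator g) x + S * B.indicator 1 x))
  have h2 := varNorm_add_le hr hr1 (hMm k) (g := fun x =>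
        maximalFn ((annulus n (k + 1)).indicator g) x + S * B.indicator 1 x)
  have h3 := varNorm_add_le hr hr1 (hMm (k + 1)) (g := fun x => S * B.indicator 1 x)
  rw [hsum]
  set b := ∑' j : ℤ,
      (volume (Metric.ball (0 : Euc n) ((2 : ℝ) ^ (max j k - 3))))⁻¹ * v (B.indicator 1) *
            ∫⁻ y, (annulus n j).indicator g y
  calc _ ≤ _ := h1
    _ ≤ 4 * (K * v ((annulus n (k - 1)).indicator g) +
        4 * (K * v ((annulus n k).indicator g) +
          4 * (K * v ((annulus n (k + 1)).indicator g) + b))) := by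
        gcongr
        · exact hK _ (hm _)
        refine h2.trans ?_
        gcongr
        · exact hK _ (hm _)
        refine h3.trans ?_
        gcongr
        exact hK _ (hm _)
    _ = 4 * (K * v ((annulus n (k - 1)).indicator g)) +
        16 * (K * v ((annulus n k).indicator g)) +
          64 * (K * v ((annulus n (k + 1)).indicator g)) + 64 * b := by ring
    _ ≤ 64 * (K * v ((annulus n (k - 1)).indicator g)) +
        64 * (K * v ((annulus n k).indicator g)) +
          64 * (K * v ((annulus n (k + 1)).indicator g)) + 64 * b := by
        gcongr <;> norm_num
    _ = _ := by ring

theorem inv_volume_mul_varNorm_mul_lintegral_le {t r : Euc n → ℝ} (ht : Measurable t)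
    (htr : ∀ x, (t x).HolderConjugate (r x)) {K C : ℝ≥0∞} (hK0 : K ≠ 0) (hC0 : C ≠ 0)
    {δ₁ δ₂ : ℝ}
    (hB : ∀ k : ℤ, varNorm t ((Metric.ball 0 ((2 : ℝ) ^ k)).indicator 1) *
        varNorm r ((Metric.ball 0 ((2 : ℝ) ^ k)).indicator 1) ≤
      K * volume (Metric.ball (0 : Euc n) ((2 : ℝ) ^ k)))
    (h₁ : ∀ j k : ℤ, j ≤ k → varNorm t ((Metric.ball 0 ((2 : ℝ) ^ j)).indicator 1) ≤
      C * (2 : ℝ≥0∞) ^ (((j : ℝ) - k) * (n * δ₁)) *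
        varNorm t ((Metric.ball 0 ((2 : ℝ) ^ k)).indicator 1))
    (h₂ : ∀ j k : ℤ, j ≤ k → varNorm r ((Metric.ball 0 ((2 : ℝ) ^ j)).indicator 1) ≤
      C * (2 : ℝ≥0∞) ^ (((j : ℝ) - k) * (n * δ₂)) *
        varNorm r ((Metric.ball 0 ((2 : ℝ) ^ k)).indicator 1))
    {σ ε : ℝ} (hε₁ : ε ≤ n * δ₁ + σ) (hε₂ : ε ≤ n * δ₂ - σ)
    (g : Euc n → ℝ≥0∞) (j k : ℤ) :
    (2 : ℝ≥0∞) ^ ((k : ℝ) * -σ) *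
        ((volume (Metric.ball (0 : Euc n) ((2 : ℝ) ^ (max j k - 3))))⁻¹ *
          varNorm r ((Metric.ball 0 ((2 : ℝ) ^ k)).indicator 1) *
            ∫⁻ y, (annulus n j).indicator g y) ≤
      2 * C * K * (2 : ℝ≥0∞) ^ ((3 : ℝ) * n) * ((2 : ℝ≥0∞) ^ (-(ε * |((j - k : ℤ) : ℝ)|)) *
        ((2 : ℝ≥0∞) ^ ((j : ℝ) * -σ) * varNorm r ((annulus n j).indicator g))) := by
  set v := varNorm r ((annulus n j).indicator g) with hv
  rcases eq_or_ne v ∞ with hvtop | hvtop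
  · rw [hvtop, ENNReal.mul_top (two_rpow_ne_zero _), ENNReal.mul_top (two_rpow_ne_zero _),
      ENNReal.mul_top]
    · exact le_top
    · exact mul_ne_zero (mul_ne_zero (mul_ne_zero two_ne_zero hC0) hK0) (two_rpow_ne_zero _)
  set w : ℤ → ℝ≥0∞ := fun i => varNorm t ((Metric.ball 0 ((2 : ℝ) ^ i)).indicator 1)
  set u : ℤ → ℝ≥0∞ := fun i => varNorm r ((Metric.ball 0 ((2 : ℝ) ^ i)).indicator 1)
  set V : ℤ → ℝ≥0∞ := fun i => volume (Metric.ball (0 : Euc n) ((2 : ℝ) ^ i))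
  have hint : ∫⁻ y, (annulus n j).indicator g y ≤ 2 * v * w j := by
    have hBm : MeasurableSet (Metric.ball (0 : Euc n) ((2 : ℝ) ^ j)) :=
      Metric.isOpen_ball.measurableSet
    refine le_trans (lintegral_mono fun y => ?_)
      (lintegral_mul_le_varNorm ht htr (measurable_one.indicator hBm)
      (varNorm_indicator_one_lt_top (fun x => (htr x).lt.le) hBm measure_ball_lt_top).ne hvtop)
    by_cases hy : y ∈ annulus n j
    · simp [hy, indicator_of_mem hy.1]
    · simp [hy]
  have hVm : ∀ i, V i * (V (i - 3))⁻¹ = (2 : ℝ≥0∞) ^ ((3 : ℝ) * n) := fun i => by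
    rw [← div_eq_mul_inv, volume_ball_two_zpow_div]
    congr 2
    push_cast
    ring
  rcases le_total j k with hle | hle
  · have hweight : (2 : ℝ≥0∞) ^ ((k : ℝ) * -σ) * (2 : ℝ≥0∞) ^ (((j : ℝ) - k) * (n * δ₁)) ≤
        (2 : ℝ≥0∞) ^ (-(ε * |((j - k : ℤ) : ℝ)|)) * (2 : ℝ≥0∞) ^ ((j : ℝ) * -σ) := by
      rw [← two_rpow_add, ← two_rpow_add]
      refine ENNReal.rpow_le_rpow_of_exponent_le (by norm_num) ?_
      have : ((j : ℝ) - k) ≤ 0 := sub_nonpos.2 (by exact_mod_cast hle)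
      push_cast
      rw [abs_of_nonpos this]
      nlinarith
    rw [max_eq_right hle]
    calc (2 : ℝ≥0∞) ^ ((k : ℝ) * -σ) * ((V (k - 3))⁻¹ * u k * ∫⁻ y, (annulus n j).indicator g y)
        ≤ (2 : ℝ≥0∞) ^ ((k : ℝ) * -σ) * ((V (k - 3))⁻¹ * u k *
          (2 * v * (C * (2 : ℝ≥0∞) ^ (((j : ℝ) - k) * (n * δ₁)) * w k))) := by
          gcongr
          exact hint.trans (by gcongr; exact h₁ j k hle)
      _ = ((2 : ℝ≥0∞) ^ ((k : ℝ) * -σ) * (2 : ℝ≥0∞) ^ (((j : ℝ) - k) * (n * δ₁))) *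
          (2 * C * (V (k - 3))⁻¹ * v) * (w k * u k) := by ring
      _ ≤ ((2 : ℝ≥0∞) ^ (-(ε * |((j - k : ℤ) : ℝ)|)) * (2 : ℝ≥0∞) ^ ((j : ℝ) * -σ)) *
          (2 * C * (V (k - 3))⁻¹ * v) * (K * V k) := by
          exact mul_le_mul' (mul_le_mul_left hweight _) (hB k)
      _ = ((2 : ℝ≥0∞) ^ (-(ε * |((j - k : ℤ) : ℝ)|)) * (2 : ℝ≥0∞) ^ ((j : ℝ) * -σ)) *
          (2 * C * v * K) * (V k * (V (k - 3))⁻¹) := by ring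
      _ = _ := by rw [hVm]; ring
  · have hweight : (2 : ℝ≥0∞) ^ ((k : ℝ) * -σ) * (2 : ℝ≥0∞) ^ (((k : ℝ) - j) * (n * δ₂)) ≤
        (2 : ℝ≥0∞) ^ (-(ε * |((j - k : ℤ) : ℝ)|)) * (2 : ℝ≥0∞) ^ ((j : ℝ) * -σ) := by
      rw [← two_rpow_add, ← two_rpow_add]
      refine ENNReal.rpow_le_rpow_of_exponent_le (by norm_num) ?_
      have : 0 ≤ ((j : ℝ) - k) := sub_nonneg.2 (by exact_mod_cast hle)
      push_cast
      rw [abs_of_nonneg this]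
      nlinarith
    rw [max_eq_left hle]
    calc (2 : ℝ≥0∞) ^ ((k : ℝ) * -σ) * ((V (j - 3))⁻¹ * u k * ∫⁻ y, (annulus n j).indicator g y)
        ≤ (2 : ℝ≥0∞) ^ ((k : ℝ) * -σ) * ((V (j - 3))⁻¹ *
          (C * (2 : ℝ≥0∞) ^ (((k : ℝ) - j) * (n * δ₂)) * u j) * (2 * v * w j)) := by
          gcongr
          exact h₂ k j hle
      _ = ((2 : ℝ≥0∞) ^ ((k : ℝ) * -σ) * (2 : ℝ≥0∞) ^ (((k : ℝ) - j) * (n * δ₂))) *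
          (2 * C * (V (j - 3))⁻¹ * v) * (w j * u j) := by ring
      _ ≤ ((2 : ℝ≥0∞) ^ (-(ε * |((j - k : ℤ) : ℝ)|)) * (2 : ℝ≥0∞) ^ ((j : ℝ) * -σ)) *
          (2 * C * (V (j - 3))⁻¹ * v) * (K * V j) := by
          exact mul_le_mul' (mul_le_mul_left hweight _) (hB j)
      _ = ((2 : ℝ≥0∞) ^ (-(ε * |((j - k : ℤ) : ℝ)|)) * (2 : ℝ≥0∞) ^ ((j : ℝ) * -σ)) *
          (2 * C * v * K) * (V j * (V (j - 3))⁻¹) := by ring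
      _ = _ := by rw [hVm]; ring

theorem ENNReal.tsum_rpow_tsum_mul_le (κ a : ℤ → ℝ≥0∞) {Q : ℝ} (hQ : 1 ≤ Q) :
    ∑' k : ℤ, (∑' j : ℤ, κ (j - k) * a j) ^ Q ≤ (∑' j, κ j) ^ Q * ∑' j, a j ^ Q := by
  have hrow : ∀ k : ℤ, ∑' j, κ (j - k) = ∑' j, κ j := fun k => (Equiv.subRight k).tsum_eq κ
  have hcol : ∀ j : ℤ, ∑' k, κ (j - k) = ∑' j, κ j := fun j => (Equiv.subLeft j).tsum_eq κ
  have hk : ∀ k : ℤ, (∑' j : ℤ, κ (j - k) * a j) ^ Q ≤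
      (∑' j, κ j) ^ (Q - 1) * ∑' j, κ (j - k) * a j ^ Q := by
    intro k
    have hmk : Measurable fun j : ℤ => κ (j - k) := measurable_of_countable _
    have h := lintegral_rpow_le_measure_univ_mul (Measure.count.withDensity fun j => κ (j - k)) hQ
      (measurable_of_countable a).aemeasurable
    rw [withDensity_apply _ MeasurableSet.univ, setLIntegral_univ,
      lintegral_withDensity_eq_lintegral_mul _ hmk (measurable_of_countable _),
      lintegral_withDensity_eq_lintegral_mul _ hmk (measurable_of_countable _),
      lintegral_count, lintegral_count, lintegral_count, hrow] at h
    simpa only [Pi.mul_apply] using h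
  calc ∑' k : ℤ, (∑' j : ℤ, κ (j - k) * a j) ^ Q
      ≤ ∑' k : ℤ, (∑' j, κ j) ^ (Q - 1) * ∑' j, κ (j - k) * a j ^ Q := ENNReal.tsum_le_tsum hk
    _ = (∑' j, κ j) ^ (Q - 1) * ((∑' j, κ j) * ∑' j, a j ^ Q) := by
        rw [ENNReal.tsum_mul_left, ENNReal.tsum_comm]
        simp_rw [ENNReal.tsum_mul_right, hcol, ENNReal.tsum_mul_left]
    _ = (∑' j, κ j) ^ Q * ∑' j, a j ^ Q := by
        rw [← mul_assoc]
        congr 1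
        nth_rewrite 2 [← ENNReal.rpow_one (∑' j, κ j)]
        rw [← ENNReal.rpow_add_of_nonneg _ _ (by linarith) zero_le_one, sub_add_cancel]

theorem herzNorm_eq (N : (Euc n → ℝ≥0∞) → ℝ≥0∞) (β : ℝ) {P : ℝ} (hP : 0 < P)
    (f : Euc n → ℝ≥0∞) : herzNorm N β P f =
      (∑' k : ℤ, ((2 : ℝ≥0∞) ^ ((k : ℝ) * β) * N ((annulus n k).indicator f)) ^ P) ^ (1 / P) := by
  unfold herzNorm
  congr 1
  refine tsum_congr fun k => ?_
  rw [ENNReal.mul_rpow_of_nonneg _ _ hP.le, ← ENNReal.rpow_mul]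
  congr 2
  ring

/-- Boundedness of the maximal operator on the Herz space over `L^{r(·)}`. -/
theorem exists_herzNorm_maximalFn_le (hn : 0 < n) {t r : Euc n → ℝ} (ht : Measurable t)
    (hr : Measurable r) (htr : ∀ x, (t x).HolderConjugate (r x)) {K C : ℝ≥0∞} (hK1 : 1 ≤ K)
    (hK : K ≠ ∞) (hC0 : C ≠ 0) (hC : C ≠ ∞) {δ₁ δ₂ : ℝ}
    (hM : ∀ f : Euc n → ℝ≥0∞, Measurable f → varNorm r (maximalFn f) ≤ K * varNorm r f)
    (hB : ∀ k : ℤ, varNorm t ((Metric.ball 0 ((2 : ℝ) ^ k)).indicator 1) *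
        varNorm r ((Metric.ball 0 ((2 : ℝ) ^ k)).indicator 1) ≤
      K * volume (Metric.ball (0 : Euc n) ((2 : ℝ) ^ k)))
    (h₁ : ∀ j k : ℤ, j ≤ k → varNorm t ((Metric.ball 0 ((2 : ℝ) ^ j)).indicator 1) ≤
      C * (2 : ℝ≥0∞) ^ (((j : ℝ) - k) * (n * δ₁)) *
        varNorm t ((Metric.ball 0 ((2 : ℝ) ^ k)).indicator 1))
    (h₂ : ∀ j k : ℤ, j ≤ k → varNorm r ((Metric.ball 0 ((2 : ℝ) ^ j)).indicator 1) ≤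
      C * (2 : ℝ≥0∞) ^ (((j : ℝ) - k) * (n * δ₂)) *
        varNorm r ((Metric.ball 0 ((2 : ℝ) ^ k)).indicator 1))
    {σ Q : ℝ} (hσ₁ : -(n * δ₁) < σ) (hσ₂ : σ < n * δ₂) (hQ : 1 ≤ Q) :
    ∃ K' : ℝ≥0∞, 1 ≤ K' ∧ K' ≠ ∞ ∧ ∀ g : Euc n → ℝ≥0∞, Measurable g →
      herzNorm (varNorm r) (-σ) Q (maximalFn g) ≤ K' * herzNorm (varNorm r) (-σ) Q g := by
  set ε := min (n * δ₁ + σ) (n * δ₂ - σ) with hεdef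
  have hε : 0 < ε := lt_min (by linarith) (by linarith)
  set κ : ℤ → ℝ≥0∞ := fun j => (2 : ℝ≥0∞) ^ (-(ε * |(j : ℝ)|)) with hκ
  have hκtop : ∑' j, κ j < ∞ := tsum_two_rpow_neg_abs_lt_top hε
  set F := 2 * C * K * (2 : ℝ≥0∞) ^ ((3 : ℝ) * n) with hF
  have hFtop : F ≠ ∞ := ENNReal.mul_ne_top (ENNReal.mul_ne_top (ENNReal.mul_ne_top
    ENNReal.ofNat_ne_top hC) hK) (two_rpow_ne_top _)
  set A := 64 * (K * (2 : ℝ≥0∞) ^ (|σ| + ε) + F) with hA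
  have hAtop : A ≠ ∞ := ENNReal.mul_ne_top ENNReal.ofNat_ne_top
    (ENNReal.add_ne_top.2 ⟨ENNReal.mul_ne_top hK (two_rpow_ne_top _), hFtop⟩)
  refine ⟨max 1 (A * ∑' j, κ j), le_max_left _ _, ?_, fun g hg => ?_⟩
  · exact (max_lt ENNReal.one_lt_top (ENNReal.mul_lt_top hAtop.lt_top hκtop)).ne
  have hB0 : ∀ k : ℤ, varNorm r ((Metric.ball 0 ((2 : ℝ) ^ k)).indicator 1) ≠ 0 := fun k =>
    varNorm_indicator_one_ne_zero hr (fun x => (htr x).symm) Metric.isOpen_ball.measurableSet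
      (volume_ball_pos 0 (zpow_pos two_pos k)).ne' measure_ball_lt_top
  set a : ℤ → ℝ≥0∞ := fun j =>
    (2 : ℝ≥0∞) ^ ((j : ℝ) * -σ) * varNorm r ((annulus n j).indicator g) with ha
  have hlayer : ∀ k : ℤ, (2 : ℝ≥0∞) ^ ((k : ℝ) * -σ) *
      varNorm r ((annulus n k).indicator (maximalFn g)) ≤ A * ∑' j, κ (j - k) * a j := by
    intro k
    have h := varNorm_annulus_maximalFn_le hn hr (fun x => (htr x).symm.lt.le) hM hB0 hg k
    refine (mul_le_mul_right h _).trans ?_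
    have hnear : (2 : ℝ≥0∞) ^ ((k : ℝ) * -σ) *
        ∑ j ∈ {k - 1, k, k + 1}, varNorm r ((annulus n j).indicator g) ≤
        (2 : ℝ≥0∞) ^ (|σ| + ε) * ∑' j, κ (j - k) * a j := by
      rw [← ENNReal.tsum_mul_left, Finset.mul_sum]
      refine le_trans (Finset.sum_le_sum fun j hj => ?_) (ENNReal.sum_le_tsum {k - 1, k, k + 1})
      rw [ha, hκ]
      simp only
      rw [← mul_assoc, ← mul_assoc, ← two_rpow_add, ← two_rpow_add]
      gcongr
      · norm_num
      have hj' : |((j - k : ℤ) : ℝ)| ≤ 1 := by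
        rw [← Int.cast_abs]
        have : |j - k| ≤ 1 := by
          simp only [Finset.mem_insert, Finset.mem_singleton] at hj
          rw [abs_le]; omega
        exact_mod_cast this
      have h2 : ((j : ℝ) - k) * σ ≤ |σ| := by
        refine (le_abs_self _).trans ?_
        rw [abs_mul]
        push_cast at hj'
        exact mul_le_of_le_one_left (abs_nonneg _) hj'
      nlinarith
    have hfar : (2 : ℝ≥0∞) ^ ((k : ℝ) * -σ) *
        ∑' j : ℤ, (volume (Metric.ball (0 : Euc n) ((2 : ℝ) ^ (max j k - 3))))⁻¹ *
          varNorm r ((Metric.ball 0 ((2 : ℝ) ^ k)).indicator 1) *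
            ∫⁻ y, (annulus n j).indicator g y ≤ F * ∑' j, κ (j - k) * a j := by
      rw [← ENNReal.tsum_mul_left, ← ENNReal.tsum_mul_left]
      exact ENNReal.tsum_le_tsum fun j => inv_volume_mul_varNorm_mul_lintegral_le ht htr
        (zero_lt_one.trans_le hK1).ne' hC0 hB h₁ h₂ (min_le_left _ _) (min_le_right _ _) g j k
    calc _ = 64 * (K * ((2 : ℝ≥0∞) ^ ((k : ℝ) * -σ) *
            ∑ j ∈ {k - 1, k, k + 1}, varNorm r ((annulus n j).indicator g)) +
          (2 : ℝ≥0∞) ^ ((k : ℝ) * -σ) *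
            ∑' j : ℤ, (volume (Metric.ball (0 : Euc n) ((2 : ℝ) ^ (max j k - 3))))⁻¹ *
              varNorm r ((Metric.ball 0 ((2 : ℝ) ^ k)).indicator 1) *
                ∫⁻ y, (annulus n j).indicator g y) := by ring
      _ ≤ 64 * (K * ((2 : ℝ≥0∞) ^ (|σ| + ε) * ∑' j, κ (j - k) * a j) +
          F * ∑' j, κ (j - k) * a j) := by gcongr
      _ = A * ∑' j, κ (j - k) * a j := by rw [hA]; ring
  have hQ0 : 0 < Q := zero_lt_one.trans_le hQ
  refine le_trans ?_ (mul_le_mul_left (le_max_right _ _) _)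
  rw [herzNorm_eq _ _ hQ0, herzNorm_eq _ _ hQ0, one_div, ENNReal.rpow_inv_le_iff hQ0,
    ENNReal.mul_rpow_of_nonneg _ _ hQ0.le, ENNReal.rpow_inv_rpow hQ0.ne']
  calc _ ≤ ∑' k : ℤ, (A * ∑' j, κ (j - k) * a j) ^ Q :=
        ENNReal.tsum_le_tsum fun k => ENNReal.rpow_le_rpow (hlayer k) hQ0.le
    _ = A ^ Q * ∑' k : ℤ, (∑' j, κ (j - k) * a j) ^ Q := by
        simp_rw [ENNReal.mul_rpow_of_nonneg _ _ hQ0.le, ENNReal.tsum_mul_left]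
    _ ≤ A ^ Q * ((∑' j, κ j) ^ Q * ∑' j, a j ^ Q) := by
        gcongr
        exact ENNReal.tsum_rpow_tsum_mul_le κ a hQ
    _ = _ := by rw [ENNReal.mul_rpow_of_nonneg A _ hQ0.le, mul_assoc]

theorem mul_varNorm_annulus_le_herzNorm (N : (Euc n → ℝ≥0∞) → ℝ≥0∞) (β : ℝ) {P : ℝ} (hP : 0 < P)
    (f : Euc n → ℝ≥0∞) (k : ℤ) :
    (2 : ℝ≥0∞) ^ ((k : ℝ) * β) * N ((annulus n k).indicator f) ≤ herzNorm N β P f := by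
  rw [herzNorm_eq N β hP, one_div, ENNReal.le_rpow_inv_iff hP]
  exact ENNReal.le_tsum (f := fun k : ℤ =>
    ((2 : ℝ≥0∞) ^ ((k : ℝ) * β) * N ((annulus n k).indicator f)) ^ P) k

theorem varNorm_annulus_ne_top {N : (Euc n → ℝ≥0∞) → ℝ≥0∞} {β P : ℝ} (hP : 0 < P)
    {f : Euc n → ℝ≥0∞} (h : herzNorm N β P f ≠ ∞) (k : ℤ) :
    N ((annulus n k).indicator f) ≠ ∞ := by
  intro htop
  have := mul_varNorm_annulus_le_herzNorm N β hP f k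
  rw [htop, ENNReal.mul_top (two_rpow_ne_zero _)] at this
  exact h (top_le_iff.1 this)

theorem ENNReal.tsum_mul_le_Lp_mul_Lq {ι : Type*} [Countable ι] (a b : ι → ℝ≥0∞) {P Q : ℝ}
    (hPQ : P.HolderConjugate Q) :
    ∑' i, a i * b i ≤ (∑' i, a i ^ P) ^ (1 / P) * (∑' i, b i ^ Q) ^ (1 / Q) := by
  let _ : MeasurableSpace ι := ⊤
  have h := ENNReal.lintegral_mul_le_Lp_mul_Lq Measure.count hPQ
    (measurable_of_countable a).aemeasurable (measurable_of_countable b).aemeasurable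
  simpa only [lintegral_count, Pi.mul_apply] using h

/-- Hölder's inequality between a Herz space over `L^{t(·)}` and its dual. -/
theorem lintegral_mul_le_herzNorm (hn : 0 < n) {t r : Euc n → ℝ} (ht : Measurable t)
    (htr : ∀ x, (t x).HolderConjugate (r x)) {σ P Q : ℝ} (hPQ : P.HolderConjugate Q)
    {F g : Euc n → ℝ≥0∞} (hF : Measurable F) (hg : Measurable g)
    (hF' : herzNorm (varNorm t) σ P F ≠ ∞) (hg' : herzNorm (varNorm r) (-σ) Q g ≠ ∞) :
    ∫⁻ x, F x * g x ≤ 2 * herzNorm (varNorm t) σ P F * herzNorm (varNorm r) (-σ) Q g := by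
  have hm : Measurable fun x => F x * g x := hF.mul hg
  rw [lintegral_eq_tsum_annulus hn hm]
  calc ∑' k : ℤ, ∫⁻ x, (annulus n k).indicator (fun x => F x * g x) x
      ≤ ∑' k : ℤ, 2 * ((2 : ℝ≥0∞) ^ ((k : ℝ) * σ) * varNorm t ((annulus n k).indicator F) *
        ((2 : ℝ≥0∞) ^ ((k : ℝ) * -σ) * varNorm r ((annulus n k).indicator g))) := by
        refine ENNReal.tsum_le_tsum fun k => ?_
        have h := lintegral_mul_le_varNorm ht htr (hF.indicator (measurableSet_annulus k))
          (varNorm_annulus_ne_top hPQ.pos hF' k) (varNorm_annulus_ne_top hPQ.symm.pos hg' k)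
        simp_rw [← inter_indicator_mul, inter_self] at h
        refine h.trans (le_of_eq ?_)
        have h1 : (2 : ℝ≥0∞) ^ ((k : ℝ) * σ) * (2 : ℝ≥0∞) ^ ((k : ℝ) * -σ) = 1 := by
          rw [← two_rpow_add]; simp
        calc _ = 2 * (varNorm t ((annulus n k).indicator F) *
              varNorm r ((annulus n k).indicator g)) *
              ((2 : ℝ≥0∞) ^ ((k : ℝ) * σ) * (2 : ℝ≥0∞) ^ ((k : ℝ) * -σ)) := by
              rw [h1, mul_one]; ring
          _ = _ := by ring
    _ ≤ _ := by
        rw [ENNReal.tsum_mul_left, mul_assoc, herzNorm_eq _ _ hPQ.pos, herzNorm_eq _ _ hPQ.symm.pos]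
        gcongr
        exact ENNReal.tsum_mul_le_Lp_mul_Lq _ _ hPQ

theorem varNorm_const_mul_le_of_ne_top {q : Euc n → ℝ} (hq : ∀ x, 0 < q x) (f : Euc n → ℝ≥0∞)
    {a : ℝ≥0∞} (h1 : a ≠ ∞) : varNorm q (fun x => a * f x) ≤ a * varNorm q f := by
  rcases eq_or_ne a 0 with rfl | h0
  · rw [varNorm_zero hq fun x => zero_mul _]
    exact zero_le
  exact varNorm_const_mul_le q f h0 h1

theorem sum_rpow_le_of_duality {t r : Euc n → ℝ} (ht : Measurable t)
    (htr : ∀ x, (t x).HolderConjugate (r x)) {tb : ℝ} (htb : ∀ x, t x ≤ tb) {σ P Q : ℝ}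
    (hPQ : P.HolderConjugate Q) {F : Euc n → ℝ≥0∞} (hF : Measurable F) (hF' : ∀ x, F x ≠ ∞)
    {A : ℝ≥0∞} (hA : ∀ g : Euc n → ℝ≥0∞, Measurable g → herzNorm (varNorm r) (-σ) Q g ≤ 1 →
      ∫⁻ x, F x * g x ≤ A) (s : Finset ℤ) {b : ℤ → ℝ≥0∞}
    (hb : ∀ k, b k = 0 ∨ b k < varNorm t ((annulus n k).indicator F)) :
    ∑ k ∈ s, ((2 : ℝ≥0∞) ^ ((k : ℝ) * σ) * b k) ^ P ≤ A ^ P := by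
  have hP := hPQ.pos
  have hQ := hPQ.symm.pos
  have hr0 : ∀ x, 0 < r x := fun x => (htr x).symm.pos
  have hex : ∀ k, ∃ g : Euc n → ℝ≥0∞, Measurable g ∧ varNorm r g ≤ 1 ∧
      (∀ x, x ∉ annulus n k → g x = 0) ∧ b k ≤ ∫⁻ x, F x * g x := by
    intro k
    rcases hb k with h | h
    · refine ⟨fun _ => 0, measurable_const, ?_, fun _ _ => rfl, by simp [h]⟩
      rw [varNorm_zero hr0 fun _ => rfl]; exact zero_le
    · obtain ⟨g, hgm, hg1, hg0, hg⟩ := exists_le_lintegral_mul ht htr htb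
        (hF.indicator (measurableSet_annulus k)) (fun x => by
          by_cases hx : x ∈ annulus n k <;> simp [hx, hF']) h
      refine ⟨g, hgm, hg1, fun x hx => hg0 x (by simp [hx]), hg.trans (lintegral_mono fun x => ?_)⟩
      exact mul_le_mul' (indicator_le_self _ _ x) le_rfl
  choose g hgm hg1 hg0 hg using hex
  set y : ℤ → ℝ≥0∞ := fun k => (2 : ℝ≥0∞) ^ ((k : ℝ) * σ) * b k with hy
  have hytop : ∀ k, y k ≠ ∞ := fun k => ENNReal.mul_ne_top (two_rpow_ne_top _) (by
    rcases hb k with h | h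
    · simp [h]
    · exact h.ne_top)
  set D := ∑ k ∈ s, y k ^ P with hD
  have hDtop : D ≠ ∞ :=
    ENNReal.sum_ne_top.2 fun k _ => ENNReal.rpow_ne_top_of_nonneg hP.le (hytop k)
  rcases eq_or_ne D 0 with hD0 | hD0
  · rw [hD0]; exact zero_le
  set c : ℤ → ℝ≥0∞ := fun k => y k ^ (P - 1) * D ^ (-(1 / Q)) with hc
  have hctop : ∀ k, c k ≠ ∞ := fun k => ENNReal.mul_ne_top
    (ENNReal.rpow_ne_top_of_nonneg hPQ.sub_one_pos.le (hytop k))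
    (ENNReal.rpow_ne_top_of_ne_zero hD0 hDtop)
  have hcQ : ∀ k, c k ^ Q = y k ^ P * D⁻¹ := fun k => by
    rw [hc]
    simp only
    rw [ENNReal.mul_rpow_of_nonneg _ _ hQ.le, ← ENNReal.rpow_mul, ← ENNReal.rpow_mul,
      hPQ.sub_one_mul_conj, ← ENNReal.rpow_neg_one]
    congr 2
    field_simp
  have hcy : ∀ k, c k * y k = y k ^ P * D ^ (-(1 / Q)) := fun k => by
    rw [hc]
    simp only
    rw [mul_right_comm]
    congr 1
    nth_rewrite 2 [← ENNReal.rpow_one (y k)]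
    rw [← ENNReal.rpow_add_of_nonneg _ _ hPQ.sub_one_pos.le zero_le_one, sub_add_cancel]
  set G : Euc n → ℝ≥0∞ := fun x => ∑ k ∈ s, (2 : ℝ≥0∞) ^ ((k : ℝ) * σ) * c k * g k x with hG
  have hGm : Measurable G := Finset.measurable_sum _ fun k _ => (hgm k).const_mul _
  have hGlayer : ∀ k : ℤ, (2 : ℝ≥0∞) ^ ((k : ℝ) * -σ) * varNorm r ((annulus n k).indicator G) ≤
      if k ∈ s then c k else 0 := by
    intro k
    split_ifs with hk
    · have hle : varNorm r ((annulus n k).indicator G) ≤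
          (2 : ℝ≥0∞) ^ ((k : ℝ) * σ) * c k * varNorm r (g k) := by
        refine le_trans (varNorm_mono (fun x => (hr0 x).le) (ae_of_all _ fun x => ?_))
          (varNorm_const_mul_le_of_ne_top hr0 (g k)
            (ENNReal.mul_ne_top (two_rpow_ne_top _) (hctop k)))
        by_cases hx : x ∈ annulus n k
        · rw [indicator_of_mem hx, hG]
          simp only
          rw [Finset.sum_eq_single_of_mem k hk fun j _ hj => by
            rw [hg0 j x fun h => hj (eq_of_mem_annulus h hx), mul_zero]]
        · simp [hx]
      calc _ ≤ (2 : ℝ≥0∞) ^ ((k : ℝ) * -σ) * ((2 : ℝ≥0∞) ^ ((k : ℝ) * σ) * c k * 1) := by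
            gcongr
            exact hle.trans (by gcongr; exact hg1 k)
        _ = c k := by
            rw [mul_one, ← mul_assoc, ← two_rpow_add]; simp
    · rw [varNorm_zero hr0, mul_zero]
      intro x
      by_cases hx : x ∈ annulus n k
      · rw [indicator_of_mem hx]
        exact Finset.sum_eq_zero fun j hj => by
          rw [hg0 j x fun h => hk (eq_of_mem_annulus h hx ▸ hj), mul_zero]
      · simp [hx]
  have hG1 : herzNorm (varNorm r) (-σ) Q G ≤ 1 := by
    rw [herzNorm_eq _ _ hQ, one_div, ENNReal.rpow_inv_le_iff hQ, ENNReal.one_rpow]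
    calc _ ≤ ∑' k : ℤ, (if k ∈ s then c k else 0) ^ Q :=
          ENNReal.tsum_le_tsum fun k => ENNReal.rpow_le_rpow (hGlayer k) hQ.le
      _ = ∑ k ∈ s, y k ^ P * D⁻¹ := by
          rw [tsum_eq_sum (s := s) fun k hk => by simp [hk, hQ]]
          exact Finset.sum_congr rfl fun k hk => by rw [if_pos hk, hcQ]
      _ = 1 := by rw [← Finset.sum_mul, ENNReal.mul_inv_cancel hD0 hDtop]
      _ ≤ 1 := le_rfl
  have hlow : D ^ (1 / P) ≤ ∫⁻ x, F x * G x := by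
    calc D ^ (1 / P) = D * D ^ (-(1 / Q)) := by
          nth_rewrite 2 [← ENNReal.rpow_one D]
          rw [← ENNReal.rpow_add _ _ hD0 hDtop]
          congr 1
          have := hPQ.inv_add_inv_eq_one
          rw [one_div, one_div]
          linarith
      _ = ∑ k ∈ s, c k * y k := by
          rw [hD, Finset.sum_mul]
          exact Finset.sum_congr rfl fun k _ => (hcy k).symm
      _ ≤ ∑ k ∈ s, (2 : ℝ≥0∞) ^ ((k : ℝ) * σ) * c k * ∫⁻ x, F x * g k x := by
          refine Finset.sum_le_sum fun k _ => ?_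
          calc c k * y k = (2 : ℝ≥0∞) ^ ((k : ℝ) * σ) * c k * b k := by rw [hy]; ring
            _ ≤ _ := by gcongr; exact hg k
      _ = ∫⁻ x, F x * G x := by
          simp_rw [hG, Finset.mul_sum]
          have hm : ∀ k ∈ s, Measurable fun x => F x * ((2 : ℝ≥0∞) ^ ((k : ℝ) * σ) * c k * g k x) :=
            fun k _ => hF.mul ((hgm k).const_mul _)
          have hm' : ∀ k, Measurable fun x => F x * g k x := fun k => hF.mul (hgm k)
          rw [lintegral_finsetSum _ hm]
          refine Finset.sum_congr rfl fun k _ => ?_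
          rw [← lintegral_const_mul _ (hm' k)]
          exact lintegral_congr fun x => by ring
  have := hlow.trans (hA G hGm hG1)
  rwa [one_div, ENNReal.rpow_inv_le_iff hP] at this

/-- The Herz norm over `L^{t(·)}` is recovered by duality. -/
theorem herzNorm_le_of_duality {t r : Euc n → ℝ} (ht : Measurable t)
    (htr : ∀ x, (t x).HolderConjugate (r x)) {tb : ℝ} (htb : ∀ x, t x ≤ tb) {σ P Q : ℝ}
    (hPQ : P.HolderConjugate Q) {F : Euc n → ℝ≥0∞} (hF : Measurable F) (hF' : ∀ x, F x ≠ ∞)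
    {A : ℝ≥0∞} (hA : ∀ g : Euc n → ℝ≥0∞, Measurable g → herzNorm (varNorm r) (-σ) Q g ≤ 1 →
      ∫⁻ x, F x * g x ≤ A) : herzNorm (varNorm t) σ P F ≤ A := by
  rw [herzNorm_eq _ _ hPQ.pos, one_div, ENNReal.rpow_inv_le_iff hPQ.pos,
    ENNReal.tsum_eq_iSup_sum]
  refine iSup_le fun s => ?_
  have hseq : ∀ k : ℤ, ∃ u : ℕ → ℝ≥0∞,
      (∀ m, u m = 0 ∨ u m < varNorm t ((annulus n k).indicator F)) ∧
      Tendsto u atTop (𝓝 (varNorm t ((annulus n k).indicator F))) := by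
    intro k
    rcases eq_or_ne (varNorm t ((annulus n k).indicator F)) 0 with h | h
    · exact ⟨fun _ => 0, fun _ => Or.inl rfl, by rw [h]; exact tendsto_const_nhds⟩
    · obtain ⟨u, -, hu, hu'⟩ := exists_seq_strictMono_tendsto' (pos_iff_ne_zero.2 h)
      exact ⟨u, fun m => Or.inr (hu m).2, hu'⟩
  choose u hu hu' using hseq
  have hlim : Tendsto (fun m => ∑ k ∈ s, ((2 : ℝ≥0∞) ^ ((k : ℝ) * σ) * u k m) ^ P) atTop
      (𝓝 (∑ k ∈ s, ((2 : ℝ≥0∞) ^ ((k : ℝ) * σ) *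
        varNorm t ((annulus n k).indicator F)) ^ P)) :=
    tendsto_finsetSum _ fun k _ => (ENNReal.Tendsto.const_mul (hu' k)
      (Or.inr (two_rpow_ne_top _))).ennrpow_const P
  exact le_of_tendsto' hlim fun m =>
    sum_rpow_le_of_duality ht htr htb hPQ hF hF' hA s fun k => hu k m

theorem exists_isA1_majorant (hn : 0 < n) {t r : Euc n → ℝ} (ht : Measurable t)
    (htr : ∀ x, (t x).HolderConjugate (r x)) {σ P Q : ℝ} (hPQ : P.HolderConjugate Q) {K : ℝ≥0∞}
    (hK1 : 1 ≤ K) (hK : K ≠ ∞) (hM : ∀ g : Euc n → ℝ≥0∞, Measurable g →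
      herzNorm (varNorm r) (-σ) Q (maximalFn g) ≤ K * herzNorm (varNorm r) (-σ) Q g)
    {g : Euc n → ℝ≥0∞} (hg : Measurable g) (hg0 : ∫⁻ x, g x ≠ 0)
    (hg1 : herzNorm (varNorm r) (-σ) Q g ≤ 1) :
    ∃ w : Euc n → ℝ≥0∞, IsA1 (2 * K) w ∧ (∀ x, g x ≤ w x) ∧
      ∀ F : Euc n → ℝ≥0∞, Measurable F → herzNorm (varNorm t) σ P F ≠ ∞ →
        ∫⁻ x, F x * w x ≤ 4 * herzNorm (varNorm t) σ P F := by
  have hK0 : K ≠ 0 := (zero_lt_one.trans_le hK1).ne'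
  have h2K0 : 2 * K ≠ 0 := mul_ne_zero two_ne_zero hK0
  have h2K : 2 * K ≠ ∞ := ENNReal.mul_ne_top ENNReal.ofNat_ne_top hK
  set h : ℕ → Euc n → ℝ≥0∞ := fun m => maximalFn^[m] g with hh
  have hsucc : ∀ m, h (m + 1) = maximalFn (h m) := fun m => Function.iterate_succ_apply' _ _ _
  have hhm : ∀ m, Measurable (h m) := by
    intro m
    cases m with
    | zero => exact hg
    | succ m => rw [hsucc]; exact measurable_maximalFn _
  have hnorm : ∀ m, herzNorm (varNorm r) (-σ) Q (h m) ≤ K ^ m := by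
    intro m
    induction m with
    | zero => simpa [hh] using hg1
    | succ m ih =>
      rw [hsucc, pow_succ']
      exact (hM _ (hhm m)).trans (by gcongr)
  set w : Euc n → ℝ≥0∞ := fun x => ∑' m : ℕ, ((2 * K) ^ m)⁻¹ * h m x with hw
  have hwm : Measurable w := Measurable.tsum fun m => (hhm m).const_mul _
  have hgw : ∀ x, g x ≤ w x := fun x => by
    refine le_trans (le_of_eq ?_)
      (ENNReal.le_tsum (f := fun m : ℕ => ((2 * K) ^ m)⁻¹ * h m x) 0)
    simp [hh]
  have hpos : ∀ x, 0 < w x := fun x => by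
    refine lt_of_lt_of_le ?_ (ENNReal.le_tsum (f := fun m : ℕ => ((2 * K) ^ m)⁻¹ * h m x) 1)
    refine ENNReal.mul_pos (ENNReal.inv_ne_zero.2 (by simpa using h2K)) ?_
    rw [hsucc]
    exact (maximalFn_pos hg0 x).ne'
  have hMw : ∀ x, maximalFn w x ≤ 2 * K * w x := by
    intro x
    calc maximalFn w x
        ≤ ∑' m : ℕ, maximalFn (fun y => ((2 * K) ^ m)⁻¹ * h m y) x :=
          maximalFn_tsum_le _ (fun m => (hhm m).const_mul _) x
      _ = ∑' m : ℕ, 2 * K * (((2 * K) ^ (m + 1))⁻¹ * h (m + 1) x) := by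
          refine tsum_congr fun m => ?_
          rw [maximalFn_const_mul _ (hhm m), ← hsucc, ← mul_assoc, pow_succ',
            ENNReal.mul_inv (Or.inl h2K0) (Or.inl h2K), ← mul_assoc,
            ENNReal.mul_inv_cancel h2K0 h2K, one_mul]
      _ = 2 * K * ∑' m : ℕ, ((2 * K) ^ (m + 1))⁻¹ * h (m + 1) x := ENNReal.tsum_mul_left
      _ ≤ 2 * K * w x := by
          gcongr
          exact ENNReal.tsum_comp_le_tsum_of_injective (add_left_injective 1)
            fun m : ℕ => ((2 * K) ^ m)⁻¹ * h m x
  have hint : ∀ F : Euc n → ℝ≥0∞, Measurable F → herzNorm (varNorm t) σ P F ≠ ∞ →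
        ∫⁻ x, F x * w x ≤ 4 * herzNorm (varNorm t) σ P F := by
    intro F hF hF'
    have hm : ∀ m, Measurable fun x => F x * (((2 * K) ^ m)⁻¹ * h m x) :=
      fun m => hF.mul ((hhm m).const_mul _)
    have hm' : ∀ m, Measurable fun x => F x * h m x := fun m => hF.mul (hhm m)
    simp_rw [hw, ← ENNReal.tsum_mul_left]
    rw [lintegral_tsum fun m => (hm m).aemeasurable]
    calc ∑' m : ℕ, ∫⁻ x, F x * (((2 * K) ^ m)⁻¹ * h m x)
        ≤ ∑' m : ℕ, 2⁻¹ ^ m * (2 * herzNorm (varNorm t) σ P F) := by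
          refine ENNReal.tsum_le_tsum fun m => ?_
          calc ∫⁻ x, F x * (((2 * K) ^ m)⁻¹ * h m x)
              = ((2 * K) ^ m)⁻¹ * ∫⁻ x, F x * h m x := by
                rw [← lintegral_const_mul _ (hm' m)]
                exact lintegral_congr fun x => by ring
            _ ≤ ((2 * K) ^ m)⁻¹ * (2 * herzNorm (varNorm t) σ P F * K ^ m) := by
                gcongr
                refine (lintegral_mul_le_herzNorm hn ht htr hPQ hF (hhm m) hF' ?_).trans ?_
                · exact ((hnorm m).trans_lt (ENNReal.pow_lt_top hK.lt_top)).ne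
                · gcongr; exact hnorm m
            _ = 2⁻¹ ^ m * (2 * herzNorm (varNorm t) σ P F) * ((K ^ m)⁻¹ * K ^ m) := by
                rw [mul_pow, ENNReal.mul_inv (Or.inl (pow_ne_zero _ two_ne_zero))
                  (Or.inl (ENNReal.pow_ne_top ENNReal.ofNat_ne_top)), ENNReal.inv_pow]
                ring
            _ = 2⁻¹ ^ m * (2 * herzNorm (varNorm t) σ P F) := by
                rw [ENNReal.inv_mul_cancel (pow_ne_zero _ hK0) (ENNReal.pow_ne_top hK), mul_one]
      _ = 4 * herzNorm (varNorm t) σ P F := by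
          rw [ENNReal.tsum_mul_right, ENNReal.tsum_geometric, ENNReal.one_sub_inv_two, inv_inv,
            ← mul_assoc]
          norm_num
  have hfin : ∀ᵐ x : Euc n, w x < ∞ := by
    have hk : ∀ k : ℤ, ∀ᵐ x : Euc n, (annulus n k).indicator 1 x * w x < ∞ := by
      intro k
      have h1m : Measurable ((annulus n k).indicator (1 : Euc n → ℝ≥0∞)) :=
        measurable_one.indicator (measurableSet_annulus k)
      have hm1 : Measurable fun x => (annulus n k).indicator 1 x * w x := h1m.mul hwm
      have hX : herzNorm (varNorm t) σ P ((annulus n k).indicator 1) ≠ ∞ := by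
        rw [herzNorm_eq _ _ hPQ.pos, tsum_eq_single k]
        · refine ENNReal.rpow_ne_top_of_nonneg (by have := hPQ.pos; positivity)
            (ENNReal.rpow_ne_top_of_nonneg hPQ.pos.le
            (ENNReal.mul_ne_top (two_rpow_ne_top _) ?_))
          rw [indicator_indicator, inter_self]
          exact (varNorm_indicator_one_lt_top (fun x => (htr x).lt.le) (measurableSet_annulus k)
            ((measure_mono sdiff_subset).trans_lt measure_ball_lt_top)).ne
        · intro j hj
          rw [varNorm_zero (fun x => (htr x).pos), mul_zero, ENNReal.zero_rpow_of_pos hPQ.pos]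
          intro x
          by_cases hx : x ∈ annulus n j
          · rw [indicator_of_mem hx, indicator_of_notMem fun h => hj (eq_of_mem_annulus hx h)]
          · simp [hx]
      exact ae_lt_top hm1 ((hint _ h1m hX).trans_lt
        (ENNReal.mul_lt_top ENNReal.ofNat_lt_top hX.lt_top)).ne
    filter_upwards [ae_all_iff.2 hk, ae_ne_zero hn] with x hx hx0
    obtain ⟨k, hxk⟩ := exists_mem_annulus hx0
    simpa [hxk] using hx k
  refine ⟨w, ⟨hwm, hfin.mono fun x hx => ⟨hpos x, hx⟩, fun x ρ hρ => ?_, ae_of_all _ hMw⟩,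
    hgw, hint⟩
  obtain ⟨z, hzB, hz⟩ := (Measure.dense_of_ae hfin).inter_open_nonempty _ Metric.isOpen_ball
    ⟨x, Metric.mem_ball_self hρ⟩
  have h1 : (volume (Metric.ball x ρ))⁻¹ * ∫⁻ y in Metric.ball x ρ, w y < ∞ :=
    ((maximalFn_ge w hρ hzB).trans (hMw z)).trans_lt (ENNReal.mul_lt_top h2K.lt_top hz)
  by_contra htop
  rw [not_lt_top_iff.1 htop, ENNReal.mul_top (ENNReal.inv_ne_zero.2 measure_ball_lt_top.ne)] at h1
  exact lt_irrefl _ h1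

/-- Extrapolation of weighted inequalities for a pair of functions. -/
theorem herzNorm_le_of_weighted (hn : 0 < n) {t r : Euc n → ℝ} (ht : Measurable t)
    (htr : ∀ x, (t x).HolderConjugate (r x)) {tb : ℝ} (htb : ∀ x, t x ≤ tb)
    {σ P Q : ℝ} (hPQ : P.HolderConjugate Q) {K : ℝ≥0∞}
    (hK1 : 1 ≤ K) (hK : K ≠ ∞) (hM : ∀ g : Euc n → ℝ≥0∞, Measurable g →
      herzNorm (varNorm r) (-σ) Q (maximalFn g) ≤ K * herzNorm (varNorm r) (-σ) Q g)
    {F G : Euc n → ℝ≥0∞} (hF : Measurable F) (hG : Measurable G) (hG' : ∀ x, G x ≠ ∞)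
    (hFX : herzNorm (varNorm t) σ P F ≠ ∞) {B : ℝ≥0∞}
    (hFG : ∀ w, IsA1 (2 * K) w → ∫⁻ x, F x * w x < ∞ →
      ∫⁻ x, G x * w x ≤ B * ∫⁻ x, F x * w x) :
    herzNorm (varNorm t) σ P G ≤ B * (4 * herzNorm (varNorm t) σ P F) := by
  refine herzNorm_le_of_duality ht htr htb hPQ hG hG' fun g hg hg1 => ?_
  rcases eq_or_ne (∫⁻ x, g x) 0 with hg0 | hg0
  · rw [lintegral_eq_zero_iff hg] at hg0
    have : ∫⁻ x, G x * g x = 0 := by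
      rw [lintegral_congr_ae (g := fun _ => 0) (hg0.mono fun x hx => by simp [hx]), lintegral_zero]
    rw [this]
    exact zero_le
  obtain ⟨w, hw, hgw, hint⟩ := exists_isA1_majorant hn ht htr hPQ hK1 hK hM hg hg0 hg1
  have hFw := hint F hF hFX
  calc ∫⁻ x, G x * g x ≤ ∫⁻ x, G x * w x := lintegral_mono fun x => mul_le_mul_right (hgw x) _
    _ ≤ B * ∫⁻ x, F x * w x :=
        hFG w hw (hFw.trans_lt (ENNReal.mul_lt_top ENNReal.ofNat_lt_top hFX.lt_top))
    _ ≤ _ := by gcongr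

theorem herzR_rpow {q : Euc n → ℝ} {α p s : ℝ} (hs : 0 < s) (hp : 0 < p) (f : Euc n → ℝ) :
    herzR (varNorm q) α p f ^ s = herzNorm (varNorm fun x => q x / s) (s * α) (p / s)
      (fun x => (‖f x‖₊ : ℝ≥0∞) ^ s) := by
  rw [herzR, herzNorm_eq _ _ hp, herzNorm_eq _ _ (div_pos hp hs), ← ENNReal.rpow_mul]
  congr 1
  · refine tsum_congr fun k => ?_
    have hind : (annulus n k).indicator (fun x => (‖f x‖₊ : ℝ≥0∞) ^ s) =
        fun x => (annulus n k).indicator (fun x => (‖f x‖₊ : ℝ≥0∞)) x ^ s := by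
      funext x
      by_cases hx : x ∈ annulus n k <;> simp [hx, hs]
    rw [hind, ← varNorm_rpow hs, show (k : ℝ) * (s * α) = k * α * s by ring,
      ENNReal.rpow_mul _ ((k : ℝ) * α) s,
      ← ENNReal.mul_rpow_of_nonneg _ _ hs.le, ← ENNReal.rpow_mul, mul_div_cancel₀ _ hs.ne']
  · rw [one_div_div]; ring

end

/-- extrapolation on variable-exponent Herz spaces. Let `0 < s < p < ∞`
and let `q(·)` be globally log-Hölder continuous with `s < q₋ ≤ q₊ < ∞`; let
`δ_{q(·)/s}, δ_{(q(·)/s)'} ∈ (0,1)` satisfy the dyadic estimates for `L^{q(·)/s}` and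
`L^{(q(·)/s)'}` and assume `−nδ_{q(·)/s} < sα < nδ_{(q(·)/s)'}`. If `T` satisfies
`‖Tf‖_{L^s_w} ≤ C([w]_{A₁})‖f‖_{L^s_w}` for all `w ∈ A₁`, then `T` is bounded on
`K̇^{α,p}_{q(·)}(ℝⁿ)`. -/
theorem stmt14 {n : ℕ} (hn : 0 < n) (α p s : ℝ) (hs : 0 < s) (hsp : s < p)
    (q qs' : Euc n → ℝ) (hqmeas : Measurable q)
    (qm qp : ℝ) (hqm : s < qm)
    (hbounds : ∀ᵐ x ∂(volume : Measure (Euc n)), qm ≤ q x ∧ q x ≤ qp)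
    (hlog : LogHolder q)
    (hqs' : ∀ᵐ x ∂(volume : Measure (Euc n)), 1 / (q x / s) + 1 / qs' x = 1)
    (δ₁ δ₂ : ℝ) (hδ₁ : 0 < δ₁ ∧ δ₁ < 1) (hδ₂ : 0 < δ₂ ∧ δ₂ < 1)
    (C : ℝ≥0∞) (hC : 0 < C ∧ C < ∞)
    (hdy₁ : ∀ (x : Euc n) (r : ℝ), 0 < r → ∀ E : Set (Euc n), MeasurableSet E →
      E ⊆ Metric.ball x r →
        varNorm (fun x => q x / s) (E.indicator 1) /
            varNorm (fun x => q x / s) ((Metric.ball x r).indicator 1)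
          ≤ C * (volume E / volume (Metric.ball x r)) ^ δ₁)
    (hdy₂ : ∀ (x : Euc n) (r : ℝ), 0 < r → ∀ E : Set (Euc n), MeasurableSet E →
      E ⊆ Metric.ball x r →
        varNorm qs' (E.indicator 1) / varNorm qs' ((Metric.ball x r).indicator 1)
          ≤ C * (volume E / volume (Metric.ball x r)) ^ δ₂)
    (hα : -((n : ℝ) * δ₁) < s * α ∧ s * α < (n : ℝ) * δ₂)
    (T : (Euc n → ℝ) → Euc n → ℝ)
    (hTmeas : ∀ f : Euc n → ℝ, Measurable f → Measurable (T f))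
    (hT : ∀ Λ : ℝ≥0∞, 1 ≤ Λ → Λ ≠ ∞ → ∃ CΛ : ℝ≥0∞, CΛ < ∞ ∧
      ∀ w : Euc n → ℝ≥0∞, IsA1 Λ w → ∀ f : Euc n → ℝ, Measurable f →
        wLpNorm s w f < ∞ → wLpNorm s w (T f) ≤ CΛ * wLpNorm s w f) :
    ∃ C' : ℝ≥0∞, 0 < C' ∧ C' < ∞ ∧
      ∀ f : Euc n → ℝ, Measurable f → herzR (varNorm q) α p f ≠ ∞ →
        herzR (varNorm q) α p (T f) ≤ C' * herzR (varNorm q) α p f := by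
  have hb := forall_of_ae_bounds hlog.continuous hbounds
  have hqp : s < qp := by linarith [(hb 0).1, (hb 0).2]
  have hqs : ∀ x, s < q x := fun x => hqm.trans_le (hb x).1
  set t : Euc n → ℝ := fun x => q x / s with ht_def
  set r : Euc n → ℝ := fun x => q x / (q x - s) with hr_def
  have ht : Measurable t := hqmeas.div_const s
  have hr : Measurable r := hqmeas.div (hqmeas.sub_const s)
  have htr : ∀ x, (t x).HolderConjugate (r x) := fun x => by
    have h1 := hqs x
    have h2 : 0 < q x := hs.trans h1
    refine Real.holderConjugate_iff.2 ⟨(one_lt_div hs).2 h1, ?_⟩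
    rw [ht_def, hr_def]
    simp only [inv_div]
    field_simp
    ring
  have htb : ∀ x, t x ≤ qp / s := fun x => div_le_div_of_nonneg_right (hb x).2 hs.le
  have hra : ∀ x, qp / (qp - s) ≤ r x := fun x => by
    have h1 := hqs x
    rw [hr_def, div_le_div_iff₀ (by linarith) (by linarith)]
    nlinarith [(hb x).2]
  have hrb : ∀ x, r x ≤ qm / (qm - s) := fun x => by
    have h1 := hqs x
    rw [hr_def, div_le_div_iff₀ (by linarith) (by linarith)]
    nlinarith [(hb x).1]
  have hqs_ae : qs' =ᵐ[volume] r := by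
    filter_upwards [hqs'] with x hx
    have h1 := hqs x
    have h2 : 0 < q x := hs.trans h1
    have h3 : 1 / qs' x = (q x - s) / q x := by
      rw [one_div_div] at hx
      rw [sub_div, div_self h2.ne']
      linarith
    rw [hr_def, ← one_div_one_div (qs' x), h3, one_div_div]
  obtain ⟨K, hK1, hK, hM⟩ := exists_varNorm_maximalFn_le hn hr
    ((one_lt_div (by linarith)).2 (by linarith)) hra hrb
    (hlog.conjExponent hn hs hqm fun x => (hb x).1)
  have hvol : ∀ k : ℤ, volume (Metric.ball (0 : Euc n) ((2 : ℝ) ^ k)) ≠ 0 :=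
    fun k => (volume_ball_pos 0 (zpow_pos two_pos k)).ne'
  have hm : ∀ k : ℤ, MeasurableSet (Metric.ball (0 : Euc n) ((2 : ℝ) ^ k)) :=
    fun k => Metric.isOpen_ball.measurableSet
  have hPs : 1 < p / s := (one_lt_div hs).2 hsp
  have hPQ := Real.HolderConjugate.conjExponent hPs
  simp only [varNorm_congr_exponent hqs_ae] at hdy₂
  obtain ⟨K', hK1', hK', hM'⟩ := exists_herzNorm_maximalFn_le hn ht hr htr hK1 hK.ne hC.1.ne'
    hC.2.ne hM
    (fun k => varNorm_ball_mul_varNorm_ball_le ht htr htb hK1 hM 0 (zpow_pos two_pos k))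
    (fun j k hjk => varNorm_ball_le_of_dyadic
      (fun i => varNorm_indicator_one_ne_zero ht htr (hm i) (hvol i) measure_ball_lt_top)
      (fun i => (varNorm_indicator_one_lt_top (fun x => (htr x).lt.le) (hm i)
        measure_ball_lt_top).ne) hdy₁ hjk)
    (fun j k hjk => varNorm_ball_le_of_dyadic
      (fun i => varNorm_indicator_one_ne_zero hr (fun x => (htr x).symm) (hm i) (hvol i)
        measure_ball_lt_top)
      (fun i => (varNorm_indicator_one_lt_top (fun x => (htr x).symm.lt.le) (hm i)
        measure_ball_lt_top).ne) hdy₂ hjk)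
    hα.1 hα.2 hPQ.symm.lt.le
  obtain ⟨D, hD, hTD⟩ := hT (2 * K') (hK1'.trans (le_mul_of_one_le_left zero_le one_le_two))
    (ENNReal.mul_ne_top ENNReal.ofNat_ne_top hK')
  have hDs : D ^ s * 4 ≠ ∞ := ENNReal.mul_ne_top
    (ENNReal.rpow_ne_top_of_nonneg hs.le hD.ne) ENNReal.ofNat_ne_top
  refine ⟨(D ^ s * 4) ^ (1 / s) + 1, by simp, ?_, fun f hf hfX => ?_⟩
  · exact ENNReal.add_lt_top.2
      ⟨(ENNReal.rpow_ne_top_of_nonneg (by positivity) hDs).lt_top, ENNReal.one_lt_top⟩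
  have hmeas : ∀ f : Euc n → ℝ, Measurable f → Measurable fun x => (‖f x‖₊ : ℝ≥0∞) ^ s :=
    fun f hf => hf.nnnorm.coe_nnreal_ennreal.pow_const s
  have hp : 0 < p := hs.trans hsp
  have hw : ∀ w, IsA1 (2 * K') w → ∫⁻ x, (‖f x‖₊ : ℝ≥0∞) ^ s * w x < ∞ →
      ∫⁻ x, (‖T f x‖₊ : ℝ≥0∞) ^ s * w x ≤ D ^ s * ∫⁻ x, (‖f x‖₊ : ℝ≥0∞) ^ s * w x := by
    intro w hw hfin
    have h := hTD w hw f hf (ENNReal.rpow_ne_top_of_nonneg (by positivity) hfin.ne).lt_top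
    rwa [wLpNorm, wLpNorm, one_div, ENNReal.rpow_inv_le_iff hs,
      ENNReal.mul_rpow_of_nonneg _ _ hs.le, ENNReal.rpow_inv_rpow hs.ne'] at h
  have hmain := herzNorm_le_of_weighted hn ht htr htb hPQ hK1' hK' hM' (hmeas f hf)
    (hmeas (T f) (hTmeas f hf))
    (fun x => ENNReal.rpow_ne_top_of_nonneg hs.le ENNReal.coe_ne_top)
    (by rw [← herzR_rpow hs hp]; exact ENNReal.rpow_ne_top_of_nonneg hs.le hfX) hw
  rw [← herzR_rpow hs hp, ← herzR_rpow hs hp, ← mul_assoc, ← ENNReal.le_rpow_inv_iff hs,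
    ENNReal.mul_rpow_of_nonneg _ _ (by positivity), ENNReal.rpow_rpow_inv hs.ne', ← one_div]
    at hmain
  exact hmain.trans (by gcongr; exact le_self_add)
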